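/- arXiv:math/0501109 — 2 statements merged into one kernel-verified Lean document; each statement's English description precedes it below -/
import Mathlib

section
/- Let m, n be positive integers, N = m+n, 0 ≤ t ≤ min(m,n), and (y,v,z,u) ∈ Σ^{m,n}_t. Let w ∈ S_N be the permutation whose matrix is the block matrix with row blocks (n,m) and column blocks (n,m): top-left w∘ⁿ·u·J^n_t·v⁻¹, top-right w∘ⁿ·u·I^{n,m}_t·z⁻¹·w∘ᵐ, bottom-left y·I^{m,n}_t·v⁻¹, bottom-right y·J^m_t·z⁻¹·w∘ᵐ. Define C_{y,z} = (B_m⁺ y B_m⁺ ∩ B_m⁻·z)·I^{m,t}_t ⊆ M_{m,t}(ℂ) and R_{u,v} = I^{t,n}_t·(B_n⁻ u⁻¹ B_n⁻ ∩ v⁻¹·B_n⁺) ⊆ M_{t,n}(ℂ). Then C_{y,z}·R_{u,v} ⊆ P_w ⊆ closure(C_{y,z}·R_{u,v}), where the closure is the Zariski closure in M_{m,n}(ℂ); in particular, the Zariski closure of P_w equals the Zariski closure of C_{y,z}·R_{u,v}. -/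
open Matrix

noncomputable section

abbrev Mat (k l : ℕ) := Matrix (Fin k) (Fin l) ℂ

/-- permutation matrix: (i,j) entry is 1 exactly when i = w j -/
def permMat (k : ℕ) (w : Equiv.Perm (Fin k)) : Mat k k :=
  fun i j => if i = w j then 1 else 0

/-- invertible upper triangular matrices -/
def Bp (k : ℕ) : Set (Mat k k) := {M | IsUnit M ∧ ∀ i j : Fin k, j < i → M i j = 0}

/-- invertible lower triangular matrices -/
def Bm (k : ℕ) : Set (Mat k k) := {M | IsUnit M ∧ ∀ i j : Fin k, i < j → M i j = 0}

def dcPlus {k l : ℕ} (w : Mat k l) : Set (Mat k l) :=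
  {x | ∃ b ∈ Bp k, ∃ b' ∈ Bp l, x = b * w * b'}

def dcMinus {k l : ℕ} (w : Mat k l) : Set (Mat k l) :=
  {x | ∃ b ∈ Bm k, ∃ b' ∈ Bm l, x = b * w * b'}

/-- comparison of finsets: sorted lists compare termwise -/
def finsetLE {k : ℕ} (A B : Finset (Fin k)) : Prop :=
  List.Forall₂ (· ≤ ·) (A.sort (· ≤ ·)) (B.sort (· ≤ ·))

/-- Bruhat order on S_k -/
def bruhatLE {k : ℕ} (y z : Equiv.Perm (Fin k)) : Prop :=
  ∀ p : Fin k, finsetLE ((Finset.Iic p).image y) ((Finset.Iic p).image z)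

/-- Zariski closure in the space of k×l matrices -/
def zClosure {k l : ℕ} (S : Set (Mat k l)) : Set (Mat k l) :=
  {x | ∀ p : MvPolynomial (Fin k × Fin l) ℂ,
      (∀ y ∈ S, MvPolynomial.eval (fun q => y q.1 q.2) p = 0) →
      MvPolynomial.eval (fun q => x q.1 q.2) p = 0}

def revP (k : ℕ) : Equiv.Perm (Fin k) := ⟨Fin.rev, Fin.rev, Fin.rev_rev, Fin.rev_rev⟩

def fe (m n : ℕ) : Fin n ⊕ Fin m ≃ Fin (m + n) :=
  finSumFinEquiv.trans (finCongr (Nat.add_comm n m))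

/-- the block matrix [[w∘ⁿ, 0],[x, w∘ᵐ]] -/
def embMat (m n : ℕ) (x : Mat m n) : Mat (m+n) (m+n) :=
  Matrix.reindex (fe m n) (fe m n)
    (Matrix.fromBlocks (permMat n (revP n)) 0 x (permMat m (revP m)))

/-- the permutation (w∘ⁿ,w∘ᵐ) ∈ S_{m+n} -/
def wnmPerm (m n : ℕ) : Equiv.Perm (Fin (m+n)) :=
  ((fe m n).symm.trans (Equiv.sumCongr (revP n) (revP m))).trans (fe m n)

def Pset (m n : ℕ) (w : Equiv.Perm (Fin (m+n))) : Set (Mat m n) :=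
  {x | embMat m n x ∈ dcPlus (permMat (m+n) w)}

/-- the matrix with t×t identity in upper-left corner, zeros elsewhere -/
def Imn (m n t : ℕ) : Mat m n := fun i j => if (i:ℕ) = (j:ℕ) ∧ (i:ℕ) < t then 1 else 0

/-- diagonal matrix with first t diagonal entries 0 and the rest 1 -/
def Jk (k t : ℕ) : Mat k k := fun i j => if (i:ℕ) = (j:ℕ) ∧ t ≤ (i:ℕ) then 1 else 0

noncomputable def subRank {k l : ℕ} (x : Mat k l) (R : Finset (Fin k)) (C : Finset (Fin l)) : ℕ :=
  (x.submatrix (fun i : {a // a ∈ R} => i.1) (fun j : {a // a ∈ C} => j.1)).rank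

/-- v(1) < ⋯ < v(t) -/
def headMono {k : ℕ} (t : ℕ) (v : Equiv.Perm (Fin k)) : Prop :=
  ∀ i j : Fin k, i < j → (j:ℕ) < t → v i < v j

/-- u(t+1) < ⋯ < u(k) -/
def tailMono {k : ℕ} (t : ℕ) (u : Equiv.Perm (Fin k)) : Prop :=
  ∀ i j : Fin k, i < j → t ≤ (i:ℕ) → u i < u j

def embPerm {k t : ℕ} (h : t ≤ k) (τ : Equiv.Perm (Fin t)) : Equiv.Perm (Fin k) :=
  τ.viaFintypeEmbedding (Fin.castLEEmb h)
/-- the block matrix for w: row blocks (n,m), column blocks (n,m) -/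
def wBlock (m n t : ℕ)
    (y : Equiv.Perm (Fin m)) (v : Equiv.Perm (Fin n))
    (z : Equiv.Perm (Fin m)) (u : Equiv.Perm (Fin n)) : Mat (m+n) (m+n) :=
  Matrix.reindex (fe m n) (fe m n)
    (Matrix.fromBlocks
      (permMat n (revP n) * permMat n u * Jk n t * permMat n v⁻¹)
      (permMat n (revP n) * permMat n u * Imn n m t * permMat m z⁻¹ * permMat m (revP m))
      (permMat m y * Imn m n t * permMat n v⁻¹)
      (permMat m y * Jk m t * permMat m z⁻¹ * permMat m (revP m)))

/-- C_{y,z} = (B_m⁺ y B_m⁺ ∩ B_m⁻·z)·I^{m,t}_t ⊆ M_{m,t} -/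
def Cset (m t : ℕ) (y z : Equiv.Perm (Fin m)) : Set (Mat m t) :=
  {c | ∃ g ∈ dcPlus (permMat m y) ∩ {g | ∃ b ∈ Bm m, g = b * permMat m z},
    c = g * Imn m t t}

/-- R_{u,v} = I^{t,n}_t·(B_n⁻ u⁻¹ B_n⁻ ∩ v⁻¹·B_n⁺) ⊆ M_{t,n} -/
def Rset (n t : ℕ) (u v : Equiv.Perm (Fin n)) : Set (Mat t n) :=
  {r | ∃ h ∈ dcMinus (permMat n u⁻¹) ∩ {h | ∃ b ∈ Bp n, h = permMat n v⁻¹ * b},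
    r = Imn t n t * h}

/-- the product set C_{y,z}·R_{u,v} ⊆ M_{m,n} -/
def CRset (m n t : ℕ) (y z : Equiv.Perm (Fin m)) (u v : Equiv.Perm (Fin n)) : Set (Mat m n) :=
  {x | ∃ c ∈ Cset m t y z, ∃ r ∈ Rset n t u v, x = c * r}

/-! ### Basic lemmas -/

theorem permMat_mul (k : ℕ) (a b : Equiv.Perm (Fin k)) :
    permMat k a * permMat k b = permMat k (a * b) := by
  ext i j
  simp only [permMat, Matrix.mul_apply, Equiv.Perm.mul_apply]
  rw [Finset.sum_eq_single (b j)]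
  · simp
    rfl
  · intro c _ hc; simp [hc]
  · simp

theorem permMat_one (k : ℕ) : permMat k 1 = 1 := by
  ext i j
  simp [permMat, Matrix.one_apply]
  rfl

theorem permMat_mul_inv (k : ℕ) (a : Equiv.Perm (Fin k)) :
    permMat k a * permMat k a⁻¹ = 1 := by
  rw [permMat_mul, mul_inv_cancel, permMat_one]

theorem permMat_inv_mul (k : ℕ) (a : Equiv.Perm (Fin k)) :
    permMat k a⁻¹ * permMat k a = 1 := by
  rw [permMat_mul, inv_mul_cancel, permMat_one]

theorem permMat_transpose (k : ℕ) (a : Equiv.Perm (Fin k)) :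
    (permMat k a)ᵀ = permMat k a⁻¹ := by
  ext i j
  simp only [permMat, Matrix.transpose_apply]
  congr 1
  rw [Equiv.Perm.eq_inv_iff_eq]
  exact propext eq_comm

theorem permMat_mul_apply {k l : ℕ} (a : Equiv.Perm (Fin k)) (A : Mat k l) (i : Fin k) (j : Fin l) :
    (permMat k a * A) i j = A (a⁻¹ i) j := by
  simp only [permMat, Matrix.mul_apply]
  rw [Finset.sum_eq_single (a⁻¹ i)]
  · simp
  · intro c _ hc
    rw [if_neg, zero_mul]
    rintro rfl
    simp at hc
  · simp

theorem mul_permMat_apply {k l : ℕ} (a : Equiv.Perm (Fin k)) (A : Mat l k) (i : Fin l) (j : Fin k) :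
    (A * permMat k a) i j = A i (a j) := by
  simp only [permMat, Matrix.mul_apply]
  rw [Finset.sum_eq_single (a j)]
  · simp
  · intro c _ hc
    simp [hc]
  · simp

theorem conj_apply {k : ℕ} (a : Equiv.Perm (Fin k)) (A : Mat k k) (i j : Fin k) :
    (permMat k a * A * permMat k a⁻¹) i j = A (a⁻¹ i) (a⁻¹ j) := by
  rw [mul_permMat_apply, permMat_mul_apply]

theorem isUnit_permMat {k : ℕ} (a : Equiv.Perm (Fin k)) : IsUnit (permMat k a) :=
  ⟨⟨_, _, permMat_mul_inv k a, permMat_inv_mul k a⟩, rfl⟩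

/-- the longest element -/
theorem rev_mul_rev (k : ℕ) : permMat k (revP k) * permMat k (revP k) = 1 := by
  rw [permMat_mul, ← permMat_one]
  congr 1
  ext i
  simp [revP]

theorem revP_inv (k : ℕ) : (revP k)⁻¹ = revP k := rfl

theorem Imn_mul (a b c t : ℕ) (h : t ≤ b) : Imn a b t * Imn b c t = Imn a c t := by
  ext i j
  simp only [Imn, Matrix.mul_apply]
  by_cases hi : (i : ℕ) < t
  · rw [Finset.sum_eq_single ⟨i, lt_of_lt_of_le hi h⟩]
    · simp [hi]
    · intro x _ hx
      rw [if_neg, zero_mul]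
      rintro ⟨h1, _⟩
      exact hx (Fin.ext h1.symm)
    · simp
  · simp [hi]

theorem Imn_mul_assoc {a b c d : ℕ} (t : ℕ) (h : t ≤ b) (X : Mat c d) :
    Imn a b t * (Imn b c t * X) = Imn a c t * X := by
  rw [← Matrix.mul_assoc, Imn_mul _ _ _ _ h]

theorem Imn_one (t : ℕ) : Imn t t t = 1 := by
  ext i j
  simp [Imn, Matrix.one_apply, Fin.ext_iff]

theorem Jk_eq (k t : ℕ) : Jk k t = 1 - Imn k k t := by
  ext i j
  simp only [Jk, Imn, Matrix.sub_apply, Matrix.one_apply, Fin.ext_iff]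
  by_cases h : (i : ℕ) = j <;> by_cases h2 : (i : ℕ) < t <;> simp [h, h2] <;> split_ifs <;> first | omega | simp

theorem Imn_mul_apply {a b c t : ℕ} (h : t ≤ b) (A : Mat b c) (i : Fin a) (j : Fin c) :
    (Imn a b t * A) i j = if hi : (i : ℕ) < t then A ⟨i, lt_of_lt_of_le hi h⟩ j else 0 := by
  simp only [Imn, Matrix.mul_apply]
  split_ifs with hi
  · rw [Finset.sum_eq_single ⟨i, lt_of_lt_of_le hi h⟩]
    · simp [hi]
    · intro x _ hx
      rw [if_neg, zero_mul]
      rintro ⟨h1, _⟩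
      exact hx (Fin.ext h1.symm)
    · simp
  · simp [hi]

theorem mul_Imn_apply {a b c t : ℕ} (h : t ≤ b) (A : Mat a b) (i : Fin a) (j : Fin c) :
    (A * Imn b c t) i j = if hj : (j : ℕ) < t then A i ⟨j, lt_of_lt_of_le hj h⟩ else 0 := by
  simp only [Imn, Matrix.mul_apply]
  split_ifs with hi
  · rw [Finset.sum_eq_single ⟨j, lt_of_lt_of_le hi h⟩]
    · simp [hi]
    · intro x _ hx
      rw [if_neg, mul_zero]
      rintro ⟨h1, _⟩
      exact hx (Fin.ext h1)
    · simp
  · refine Finset.sum_eq_zero fun x _ => ?_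
    rw [if_neg, mul_zero]
    omega

/-! ### Triangular matrices -/

theorem Bp_mul {k : ℕ} {A B : Mat k k} (hA : A ∈ Bp k) (hB : B ∈ Bp k) : A * B ∈ Bp k := by
  refine ⟨hA.1.mul hB.1, fun i j hij => ?_⟩
  rw [Matrix.mul_apply]
  refine Finset.sum_eq_zero fun x _ => ?_
  rcases lt_or_ge x i with h | h
  · rw [hA.2 _ _ h, zero_mul]
  · rw [hB.2 _ _ (lt_of_lt_of_le hij h), mul_zero]

theorem Bm_transpose {k : ℕ} {A : Mat k k} : Aᵀ ∈ Bm k ↔ A ∈ Bp k := by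
  simp only [Bm, Bp, Set.mem_ofPred_eq, Matrix.isUnit_transpose, Matrix.transpose_apply]
  constructor
  · rintro ⟨h, h'⟩; exact ⟨h, fun i j hij => h' _ _ hij⟩
  · rintro ⟨h, h'⟩; exact ⟨h, fun i j hij => h' _ _ hij⟩

theorem Bp_transpose {k : ℕ} {A : Mat k k} : Aᵀ ∈ Bp k ↔ A ∈ Bm k := by
  rw [← Bm_transpose, Matrix.transpose_transpose]

theorem Bm_mul {k : ℕ} {A B : Mat k k} (hA : A ∈ Bm k) (hB : B ∈ Bm k) : A * B ∈ Bm k := by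
  rw [← Bp_transpose] at *
  rw [Matrix.transpose_mul]
  exact Bp_mul hB hA

theorem Bp_inv {k : ℕ} {A : Mat k k} (hA : A ∈ Bp k) :
    ∃ B ∈ Bp k, A * B = 1 ∧ B * A = 1 := by
  obtain ⟨u, hu⟩ := hA.1
  have hdet : IsUnit A.det := (Matrix.isUnit_iff_isUnit_det A).1 hA.1
  let _ : Invertible A := A.invertibleOfIsUnitDet hdet
  refine ⟨A⁻¹, ⟨(Matrix.isUnit_nonsing_inv_iff).2 hA.1, ?_⟩, Matrix.mul_nonsing_inv _ hdet,
    Matrix.nonsing_inv_mul _ hdet⟩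
  have : Matrix.BlockTriangular A id := fun i j hij => hA.2 i j hij
  have h2 := Matrix.blockTriangular_inv_of_blockTriangular this
  exact fun i j hij => h2 hij

theorem Bm_inv {k : ℕ} {A : Mat k k} (hA : A ∈ Bm k) :
    ∃ B ∈ Bm k, A * B = 1 ∧ B * A = 1 := by
  obtain ⟨B, hB, h1, h2⟩ := Bp_inv (Bp_transpose.2 hA)
  refine ⟨Bᵀ, Bm_transpose.2 hB, ?_, ?_⟩
  · rw [← Matrix.transpose_transpose A, ← Matrix.transpose_mul, h2, Matrix.transpose_one]
  · rw [← Matrix.transpose_transpose A, ← Matrix.transpose_mul, h1, Matrix.transpose_one]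

theorem revconj_Bm {k : ℕ} {A : Mat k k} (hA : A ∈ Bp k) :
    permMat k (revP k) * A * permMat k (revP k) ∈ Bm k := by
  refine ⟨((isUnit_permMat _).mul hA.1).mul (isUnit_permMat _), fun i j hij => ?_⟩
  have := conj_apply (revP k) A i j
  rw [revP_inv] at this
  rw [this]
  exact hA.2 _ _ (Fin.rev_lt_rev.2 hij)

theorem revconj_Bp {k : ℕ} {A : Mat k k} (hA : A ∈ Bm k) :
    permMat k (revP k) * A * permMat k (revP k) ∈ Bp k := by
  refine ⟨((isUnit_permMat _).mul hA.1).mul (isUnit_permMat _), fun i j hij => ?_⟩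
  have := conj_apply (revP k) A i j
  rw [revP_inv] at this
  rw [this]
  exact hA.2 _ _ (Fin.rev_lt_rev.2 hij)

/-! ### Blocks -/

theorem fe_inl (m n : ℕ) (i : Fin n) : ((fe m n (Sum.inl i) : Fin (m+n)) : ℕ) = i := by
  simp [fe]

theorem fe_inr (m n : ℕ) (i : Fin m) : ((fe m n (Sum.inr i) : Fin (m+n)) : ℕ) = n + i := by
  simp [fe, add_comm]

def blk (m n : ℕ) (A : Mat n n) (B : Mat n m) (C : Mat m n) (D : Mat m m) : Mat (m+n) (m+n) :=
  Matrix.reindex (fe m n) (fe m n) (Matrix.fromBlocks A B C D)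

theorem blk_mul (m n : ℕ) (A : Mat n n) (B : Mat n m) (C : Mat m n) (D : Mat m m)
    (A' : Mat n n) (B' : Mat n m) (C' : Mat m n) (D' : Mat m m) :
    blk m n A B C D * blk m n A' B' C' D' =
      blk m n (A * A' + B * C') (A * B' + B * D') (C * A' + D * C') (C * B' + D * D') := by
  simp only [blk, Matrix.reindex_apply, Matrix.submatrix_mul_equiv, Matrix.fromBlocks_multiply]

theorem blk_inj {m n : ℕ} {A : Mat n n} {B : Mat n m} {C : Mat m n} {D : Mat m m}
    {A' : Mat n n} {B' : Mat n m} {C' : Mat m n} {D' : Mat m m}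
    (h : blk m n A B C D = blk m n A' B' C' D') : A = A' ∧ B = B' ∧ C = C' ∧ D = D' := by
  simp only [blk] at h
  exact Matrix.fromBlocks_inj.1 ((Matrix.reindex (fe m n) (fe m n)).injective h)

theorem exists_blk {m n : ℕ} (M : Mat (m+n) (m+n)) : ∃ A B C D, M = blk m n A B C D := by
  refine ⟨((Matrix.reindex (fe m n) (fe m n)).symm M).toBlocks₁₁,
    ((Matrix.reindex (fe m n) (fe m n)).symm M).toBlocks₁₂,
    ((Matrix.reindex (fe m n) (fe m n)).symm M).toBlocks₂₁,
    ((Matrix.reindex (fe m n) (fe m n)).symm M).toBlocks₂₂, ?_⟩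
  unfold blk
  rw [Matrix.fromBlocks_toBlocks, Equiv.apply_symm_apply]

theorem blk_one (m n : ℕ) : blk m n 1 0 0 1 = 1 := by
  simp [blk]

theorem isUnit_blk (m n : ℕ) (A : Mat n n) (B : Mat n m) (D : Mat m m) :
    IsUnit (blk m n A B 0 D) ↔ IsUnit A ∧ IsUnit D := by
  rw [Matrix.isUnit_iff_isUnit_det, Matrix.isUnit_iff_isUnit_det, Matrix.isUnit_iff_isUnit_det,
    blk, Matrix.det_reindex_self, Matrix.det_fromBlocks_zero₂₁, IsUnit.mul_iff]

theorem blk_Bp {m n : ℕ} {A : Mat n n} {B : Mat n m} {C : Mat m n} {D : Mat m m} :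
    blk m n A B C D ∈ Bp (m+n) ↔ A ∈ Bp n ∧ D ∈ Bp m ∧ C = 0 := by
  have key : (∀ i j : Fin (m+n), j < i → blk m n A B C D i j = 0) ↔
      (∀ i j, j < i → A i j = 0) ∧ (∀ i j, j < i → D i j = 0) ∧ C = 0 := by
    constructor
    · intro h
      refine ⟨fun i j hij => ?_, fun i j hij => ?_, ?_⟩
      · have := h (fe m n (Sum.inl i)) (fe m n (Sum.inl j))
          (by rw [Fin.lt_def, fe_inl, fe_inl]; exact hij)
        simpa [blk] using this
      · have := h (fe m n (Sum.inr i)) (fe m n (Sum.inr j))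
          (by rw [Fin.lt_def, fe_inr, fe_inr]; simpa using hij)
        simpa [blk] using this
      · ext i j
        have := h (fe m n (Sum.inr i)) (fe m n (Sum.inl j))
          (by rw [Fin.lt_def, fe_inr, fe_inl]; omega)
        simpa [blk] using this
    · rintro ⟨h1, h2, rfl⟩ i j hij
      obtain ⟨i, rfl⟩ := (fe m n).surjective i
      obtain ⟨j, rfl⟩ := (fe m n).surjective j
      rw [Fin.lt_def] at hij
      rcases i with i | i <;> rcases j with j | j <;>
        simp only [fe_inl, fe_inr] at hij <;> simp only [blk, Matrix.reindex_apply,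
          Matrix.submatrix_apply, Equiv.symm_apply_apply, Matrix.fromBlocks_apply₁₁,
          Matrix.fromBlocks_apply₁₂, Matrix.fromBlocks_apply₂₁, Matrix.fromBlocks_apply₂₂]
      · exact h1 _ _ hij
      · omega
      · rfl
      · exact h2 _ _ (by rw [Fin.lt_def]; omega)
  simp only [Bp, Set.mem_ofPred_eq, key]
  constructor
  · rintro ⟨h1, h2, h3, rfl⟩
    rw [isUnit_blk] at h1
    exact ⟨⟨h1.1, h2⟩, ⟨h1.2, h3⟩, rfl⟩
  · rintro ⟨h2, h3, rfl⟩
    exact ⟨(isUnit_blk _ _ _ _ _).2 ⟨h2.1, h3.1⟩, h2.2, h3.2, rfl⟩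

theorem embMat_eq (m n : ℕ) (x : Mat m n) :
    embMat m n x = blk m n (permMat n (revP n)) 0 x (permMat m (revP m)) := rfl

/-! ### Description of `Pset` by block equations -/

theorem mem_Pset_of {m n t : ℕ}
    {y : Equiv.Perm (Fin m)} {v : Equiv.Perm (Fin n)}
    {z : Equiv.Perm (Fin m)} {u : Equiv.Perm (Fin n)}
    {w : Equiv.Perm (Fin (m+n))} (hw : permMat (m+n) w = wBlock m n t y v z u) {x : Mat m n}
    {Bi : Mat m m} {D : Mat n n} {e : Mat n n} {f : Mat m m} {q : Mat n m}
    (hBi : Bi ∈ Bp m) (hD : D ∈ Bm n) (he : e ∈ Bp n) (hf : f ∈ Bm m)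
    (h1 : Bi * x = permMat m y * (Imn m n t * (permMat n v⁻¹ * e)))
    (h2 : Bi = permMat m y * (Imn m n t * q + Jk m t * (permMat m z⁻¹ * f)))
    (h3 : D = permMat n u * (Jk n t * (permMat n v⁻¹ * e) -
      (Jk n t * q + Imn n m t * (permMat m z⁻¹ * f)) * x)) :
    x ∈ Pset m n w := by
  change embMat m n x ∈ dcPlus (permMat (m+n) w)
  have rr : ∀ {k l : ℕ} (X : Mat k l), permMat k (revP k) * (permMat k (revP k) * X) = X := by
    intro k l X
    rw [← Matrix.mul_assoc, rev_mul_rev, Matrix.one_mul]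
  have vv : ∀ {l : ℕ} (X : Mat n l), permMat n v⁻¹ * (permMat n v * X) = X := by
    intro l X
    rw [← Matrix.mul_assoc, permMat_inv_mul, Matrix.one_mul]
  set S : Mat n m := permMat n (revP n) * (permMat n u *
    (Jk n t * q + Imn n m t * (permMat m z⁻¹ * f))) with hS
  have hB : blk m n (permMat n (revP n) * D * permMat n (revP n)) S 0 Bi ∈ Bp (m+n) :=
    blk_Bp.2 ⟨revconj_Bp hD, hBi, rfl⟩
  have hE : blk m n e (permMat n v * (q * permMat m (revP m))) 0
      (permMat m (revP m) * f * permMat m (revP m)) ∈ Bp (m+n) :=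
    blk_Bp.2 ⟨he, revconj_Bp hf, rfl⟩
  obtain ⟨B', hB', hBB, hBB'⟩ := Bp_inv hB
  refine ⟨B', hB', _, hE, ?_⟩
  have key : blk m n (permMat n (revP n) * D * permMat n (revP n)) S 0 Bi * embMat m n x =
      permMat (m+n) w * blk m n e (permMat n v * (q * permMat m (revP m))) 0
      (permMat m (revP m) * f * permMat m (revP m)) := by
    rw [hw, embMat_eq]
    change _ = blk m n _ _ _ _ * _
    rw [blk_mul, blk_mul]
    congr 1
    · rw [h3, hS]
      simp only [Matrix.mul_assoc, rev_mul_rev, Matrix.mul_one, Matrix.mul_sub, Matrix.mul_add,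
        Matrix.add_mul, Matrix.mul_zero, add_zero]
      abel
    · rw [hS]
      simp only [Matrix.mul_assoc, rr, vv, Matrix.mul_sub, Matrix.mul_add,
        Matrix.add_mul, Matrix.mul_zero, zero_add]
    · simp only [Matrix.zero_mul, zero_add, Matrix.mul_zero, add_zero, h1, Matrix.mul_assoc]
    · conv_lhs => rw [h2]
      simp only [Matrix.mul_assoc, rr, vv, Matrix.mul_sub, Matrix.mul_add,
        Matrix.add_mul, Matrix.mul_zero, zero_add]
  rw [Matrix.mul_assoc, ← key, ← Matrix.mul_assoc, hBB', Matrix.one_mul]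

theorem exists_of_mem_Pset {m n t : ℕ}
    {y : Equiv.Perm (Fin m)} {v : Equiv.Perm (Fin n)}
    {z : Equiv.Perm (Fin m)} {u : Equiv.Perm (Fin n)}
    {w : Equiv.Perm (Fin (m+n))} (hw : permMat (m+n) w = wBlock m n t y v z u) {x : Mat m n}
    (hx : x ∈ Pset m n w) :
    ∃ Bi ∈ Bp m, ∃ D ∈ Bm n, ∃ e ∈ Bp n, ∃ f ∈ Bm m, ∃ q : Mat n m,
      Bi * x = permMat m y * (Imn m n t * (permMat n v⁻¹ * e)) ∧
      Bi = permMat m y * (Imn m n t * q + Jk m t * (permMat m z⁻¹ * f)) ∧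
      D = permMat n u * (Jk n t * (permMat n v⁻¹ * e) -
        (Jk n t * q + Imn n m t * (permMat m z⁻¹ * f)) * x) := by
  have rr : ∀ {k l : ℕ} (X : Mat k l), permMat k (revP k) * (permMat k (revP k) * X) = X := by
    intro k l X
    rw [← Matrix.mul_assoc, rev_mul_rev, Matrix.one_mul]
  obtain ⟨b, hb, b', hb', hE⟩ := hx
  obtain ⟨B, hB, hbB, hBb⟩ := Bp_inv hb
  have key : B * embMat m n x = permMat (m+n) w * b' := by
    rw [hE, Matrix.mul_assoc b, ← Matrix.mul_assoc B, hBb, Matrix.one_mul]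
  obtain ⟨A, S, C, Bi, rfl⟩ := exists_blk B
  obtain ⟨e, e12, C', e2, rfl⟩ := exists_blk b'
  obtain ⟨hA, hBi, rfl⟩ := blk_Bp.1 hB
  obtain ⟨he, he2, rfl⟩ := blk_Bp.1 hb'
  rw [hw, embMat_eq] at key
  change _ = blk m n _ _ _ _ * _ at key
  rw [blk_mul, blk_mul] at key
  obtain ⟨k1, k2, k3, k4⟩ := blk_inj key
  simp only [Matrix.zero_mul, zero_add, Matrix.mul_zero, add_zero, Matrix.mul_assoc] at k1 k2 k3 k4
  have hBi2 : Bi = (Bi * permMat m (revP m)) * permMat m (revP m) := by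
    rw [Matrix.mul_assoc, rev_mul_rev, Matrix.mul_one]
  have hS2 : S = (S * permMat m (revP m)) * permMat m (revP m) := by
    rw [Matrix.mul_assoc, rev_mul_rev, Matrix.mul_one]
  refine ⟨Bi, hBi, permMat n (revP n) * A * permMat n (revP n), revconj_Bm hA, e, he,
    permMat m (revP m) * e2 * permMat m (revP m), revconj_Bm he2,
    permMat n v⁻¹ * (e12 * permMat m (revP m)), k3, ?_, ?_⟩
  · conv_lhs => rw [hBi2, k4]
    simp only [Matrix.mul_assoc, Matrix.mul_add, Matrix.add_mul]
  · have : A * permMat n (revP n) = (permMat n (revP n) *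
        (permMat n u * (Jk n t * (permMat n v⁻¹ * e)))) - S * x := by
      rw [← k1]; abel
    rw [Matrix.mul_assoc, this, hS2, k2]
    simp only [Matrix.mul_assoc, rr, Matrix.mul_sub, Matrix.mul_add, Matrix.add_mul]

theorem isUnit_of_mul_one {k : ℕ} {A B : Mat k k} (h : A * B = 1) : IsUnit A :=
  ⟨⟨A, B, h, mul_eq_one_comm.1 h⟩, rfl⟩

/-! ### Block-triangular conjugations -/

theorem IAI_apply {k t : ℕ} (A : Mat t t) (i j : Fin k) :
    (Imn k t t * A * Imn t k t + Jk k t) i j =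
      if hij : (i : ℕ) < t ∧ (j : ℕ) < t then A ⟨i, hij.1⟩ ⟨j, hij.2⟩ else
      if i = j then 1 else 0 := by
  rw [Matrix.add_apply, mul_Imn_apply le_rfl]
  simp only [Jk]
  by_cases hj : (j : ℕ) < t
  · rw [dif_pos hj, Imn_mul_apply le_rfl]
    by_cases hi : (i : ℕ) < t
    · rw [dif_pos hi, dif_pos ⟨hi, hj⟩, if_neg (by omega), add_zero]
    · rw [dif_neg hi, dif_neg (by tauto), if_neg (by omega), if_neg (by omega), add_zero]
  · rw [dif_neg hj, dif_neg (by tauto), zero_add]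
    by_cases hij : i = j
    · subst hij; simp [not_lt.1 hj]
    · rw [if_neg (fun h => hij (Fin.ext h.1)), if_neg hij]

theorem IAI_mul {k t : ℕ} (h : t ≤ k) (A B : Mat t t) :
    (Imn k t t * A * Imn t k t + Jk k t) * (Imn k t t * B * Imn t k t + Jk k t) =
    Imn k t t * (A * B) * Imn t k t + Jk k t := by
  simp only [Jk_eq, Matrix.mul_add, Matrix.add_mul, Matrix.mul_assoc, Matrix.mul_sub,
    Matrix.sub_mul, Matrix.one_mul, Matrix.mul_one, Imn_mul _ _ _ _ h, Imn_mul_assoc _ h,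
    Imn_mul _ _ _ _ (le_refl t), Imn_one]
  abel

theorem IAI_one {k t : ℕ} : Imn k t t * (1 : Mat t t) * Imn t k t + Jk k t = 1 := by
  rw [Matrix.mul_one, Imn_mul _ _ _ _ le_rfl, Jk_eq]; abel

theorem isUnit_IAI {k t : ℕ} (h : t ≤ k) {A : Mat t t} (hA : IsUnit A) :
    IsUnit (Imn k t t * A * Imn t k t + Jk k t) := by
  obtain ⟨a, rfl⟩ := hA
  apply isUnit_of_mul_one (B := Imn k t t * (a⁻¹ : (Mat t t)ˣ).1 * Imn t k t + Jk k t)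
  rw [IAI_mul h, a.mul_inv, IAI_one]

theorem head_conj_Bp {k t : ℕ} (h : t ≤ k) {v : Equiv.Perm (Fin k)} (hv : headMono t v)
    {A : Mat t t} (hA : A ∈ Bp t) :
    permMat k v * (Imn k t t * A * Imn t k t + Jk k t) * permMat k v⁻¹ ∈ Bp k := by
  refine ⟨((isUnit_permMat _).mul (isUnit_IAI h hA.1)).mul (isUnit_permMat _), fun i j hij => ?_⟩
  rw [conj_apply, IAI_apply]
  split_ifs with h1 h2
  · apply hA.2
    by_contra h3
    rcases eq_or_lt_of_le (not_lt.1 h3) with h4 | h4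
    · simp only [Fin.mk.injEq] at h4
      have := v⁻¹.injective (Fin.ext h4)
      exact hij.ne' this
    · have := hv (v⁻¹ i) (v⁻¹ j) h4 h1.2
      simp at this
      exact absurd hij (not_lt.2 this.le)
  · exact absurd (v⁻¹.injective h2) hij.ne'
  · rfl

theorem head_conj_Bm {k t : ℕ} (h : t ≤ k) {v : Equiv.Perm (Fin k)} (hv : headMono t v)
    {A : Mat t t} (hA : A ∈ Bm t) :
    permMat k v * (Imn k t t * A * Imn t k t + Jk k t) * permMat k v⁻¹ ∈ Bm k := by
  refine ⟨((isUnit_permMat _).mul (isUnit_IAI h hA.1)).mul (isUnit_permMat _), fun i j hij => ?_⟩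
  rw [conj_apply, IAI_apply]
  split_ifs with h1 h2
  · apply hA.2
    by_contra h3
    rcases eq_or_lt_of_le (not_lt.1 h3) with h4 | h4
    · simp only [Fin.mk.injEq] at h4
      have := v⁻¹.injective (Fin.ext h4)
      exact hij.ne' this
    · have := hv (v⁻¹ j) (v⁻¹ i) h4 h1.1
      simp at this
      exact absurd hij (not_lt.2 this.le)
  · exact absurd (v⁻¹.injective h2) hij.ne
  · rfl

/-- principal `t × t` block of a triangular matrix -/
theorem Bp_head {k t : ℕ} (h : t ≤ k) {A B : Mat k k} (hA : A ∈ Bp k) (hB : B ∈ Bp k)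
    (hAB : A * B = 1) :
    (Imn t k t * A * Imn k t t) ∈ Bp t ∧
      (Imn t k t * A * Imn k t t) * (Imn t k t * B * Imn k t t) = 1 := by
  have hB' : Imn k k t * (B * Imn k t t) = B * Imn k t t := by
    ext i j
    simp only [Imn_mul_apply h, mul_Imn_apply h, j.2, dite_true]
    split_ifs with hi
    · rfl
    · symm; apply hB.2; rw [Fin.lt_def]; simp only; omega
  have h1 : (Imn t k t * A * Imn k t t) * (Imn t k t * B * Imn k t t) = 1 := by
    simp only [Matrix.mul_assoc, Imn_mul_assoc _ (le_refl t)]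
    rw [hB', ← Matrix.mul_assoc A, hAB, Matrix.one_mul, Imn_mul _ _ _ _ h, Imn_one]
  refine ⟨⟨isUnit_of_mul_one h1, fun i j hij => ?_⟩, h1⟩
  rw [mul_Imn_apply h, dif_pos j.2, Imn_mul_apply h, dif_pos i.2]
  exact hA.2 _ _ hij

theorem Bm_head {k t : ℕ} (h : t ≤ k) {A B : Mat k k} (hA : A ∈ Bm k) (hB : B ∈ Bm k)
    (hAB : A * B = 1) :
    (Imn t k t * A * Imn k t t) ∈ Bm t ∧
      (Imn t k t * A * Imn k t t) * (Imn t k t * B * Imn k t t) = 1 := by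
  have hB' : Imn t k t * (A * Imn k k t) = Imn t k t * A := by
    ext i j
    simp only [Imn_mul_apply h, mul_Imn_apply h, i.2, dite_true]
    split_ifs with hi
    · rfl
    · symm; apply hA.2; rw [Fin.lt_def]; simp only; omega
  have h1 : (Imn t k t * A * Imn k t t) * (Imn t k t * B * Imn k t t) = 1 := by
    simp only [Matrix.mul_assoc, Imn_mul_assoc _ (le_refl t)]
    rw [← Matrix.mul_assoc A, ← Matrix.mul_assoc (Imn t k t), hB', Matrix.mul_assoc,
      ← Matrix.mul_assoc A, hAB, Matrix.one_mul, Imn_mul _ _ _ _ h, Imn_one]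
  refine ⟨⟨isUnit_of_mul_one h1, fun i j hij => ?_⟩, h1⟩
  rw [mul_Imn_apply h, dif_pos j.2, Imn_mul_apply h, dif_pos i.2]
  exact hA.2 _ _ hij

theorem Jk_mul_apply {k l t : ℕ} (A : Mat k l) (i : Fin k) (j : Fin l) :
    (Jk k t * A) i j = if t ≤ (i : ℕ) then A i j else 0 := by
  simp only [Jk, Matrix.mul_apply]
  rw [Finset.sum_eq_single i]
  · simp
  · intro x _ hx
    rw [if_neg, zero_mul]
    rintro ⟨h1, _⟩
    exact hx (Fin.ext h1.symm)
  · simp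

theorem mul_Jk_apply {k l t : ℕ} (A : Mat l k) (i : Fin l) (j : Fin k) :
    (A * Jk k t) i j = if t ≤ (j : ℕ) then A i j else 0 := by
  simp only [Jk, Matrix.mul_apply]
  rw [Finset.sum_eq_single j]
  · simp
  · intro x _ hx
    rw [if_neg, mul_zero]
    rintro ⟨h1, _⟩
    exact hx (Fin.ext h1)
  · simp

theorem Jk_Imn (k l t : ℕ) (h : t ≤ k) : Jk k t * Imn k l t = 0 := by
  rw [Jk_eq, Matrix.sub_mul, Matrix.one_mul, Imn_mul _ _ _ _ h, sub_self]

theorem Imn_Jk (k l t : ℕ) (h : t ≤ k) : Imn l k t * Jk k t = 0 := by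
  rw [Jk_eq, Matrix.mul_sub, Matrix.mul_one, Imn_mul _ _ _ _ h, sub_self]

theorem Jk_Jk (k t : ℕ) (h : t ≤ k) : Jk k t * Jk k t = Jk k t := by
  conv_lhs => arg 2; rw [Jk_eq]
  rw [Matrix.mul_sub, Jk_Imn _ _ _ h, Matrix.mul_one, sub_zero]

theorem Jk_Imn_assoc {k l t r : ℕ} (h : t ≤ k) (X : Mat l r) :
    Jk k t * (Imn k l t * X) = 0 := by
  rw [← Matrix.mul_assoc, Jk_Imn _ _ _ h, Matrix.zero_mul]

theorem Imn_Jk_assoc {k l t r : ℕ} (h : t ≤ k) (X : Mat k r) :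
    Imn l k t * (Jk k t * X) = 0 := by
  rw [← Matrix.mul_assoc, Imn_Jk _ _ _ h, Matrix.zero_mul]

theorem Jk_Jk_assoc {k t r : ℕ} (h : t ≤ k) (X : Mat k r) :
    Jk k t * (Jk k t * X) = Jk k t * X := by
  rw [← Matrix.mul_assoc, Jk_Jk _ _ h]

theorem tail_conj_Bp {k t : ℕ} (h : t ≤ k) {y : Equiv.Perm (Fin k)} (hy : tailMono t y)
    {A : Mat k k} (hA : A ∈ Bp k) :
    permMat k y * (Imn k k t + Jk k t * A) * permMat k y⁻¹ ∈ Bp k := by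
  obtain ⟨B, hB, hAB, hBA⟩ := Bp_inv hA
  have hJ : ∀ {A : Mat k k}, A ∈ Bp k → Jk k t * (A * Jk k t) = Jk k t * A := by
    intro A hA
    ext i j
    simp only [Jk_mul_apply, mul_Jk_apply]
    split_ifs with h1 h2
    · rfl
    · symm; apply hA.2; rw [Fin.lt_def]; omega
    · rfl
  have hunit : IsUnit (Imn k k t + Jk k t * A) := by
    apply isUnit_of_mul_one (B := Imn k k t + Jk k t * B)
    have e1 : Jk k t * (A * Imn k k t) = 0 := by
      rw [show Imn k k t = 1 - Jk k t by rw [Jk_eq]; abel, Matrix.mul_sub, Matrix.mul_sub, hJ hA,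
        Matrix.mul_one, sub_self]
    have e2 : Jk k t * (A * (Jk k t * B)) = Jk k t := by
      rw [← Matrix.mul_assoc, ← Matrix.mul_assoc, Matrix.mul_assoc (Jk k t) A, hJ hA,
        Matrix.mul_assoc, hAB, Matrix.mul_one]
    simp only [Matrix.mul_add, Matrix.add_mul, Matrix.mul_assoc, e1, e2, Imn_Jk_assoc h,
      Imn_mul _ _ _ _ h, zero_add, add_zero]
    rw [Jk_eq]
    abel
  refine ⟨((isUnit_permMat _).mul hunit).mul (isUnit_permMat _), fun i j hij => ?_⟩
  rw [conj_apply, Matrix.add_apply, Jk_mul_apply]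
  simp only [Imn]
  split_ifs with h1 h2 h2
  · omega
  · exact absurd (y⁻¹.injective (Fin.ext h1.1)) hij.ne'
  · rw [zero_add]
    apply hA.2
    by_contra h3
    rcases eq_or_lt_of_le (not_lt.1 h3) with h4 | h4
    · have := y⁻¹.injective h4
      exact hij.ne' this
    · have := hy _ _ h4 h2
      simp at this
      exact absurd hij (not_lt.2 this.le)
  · simp

theorem tail_conj_Bm {k t : ℕ} (h : t ≤ k) {u : Equiv.Perm (Fin k)} (hu : tailMono t u)
    {A : Mat k k} (hA : A ∈ Bm k) :
    permMat k u * (Jk k t * A * Jk k t - Imn k k t) * permMat k u⁻¹ ∈ Bm k := by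
  obtain ⟨B, hB, hAB, hBA⟩ := Bm_inv hA
  have hJ : ∀ {A : Mat k k}, A ∈ Bm k → Jk k t * (A * Jk k t) = A * Jk k t := by
    intro A hA
    ext i j
    simp only [Jk_mul_apply, mul_Jk_apply]
    split_ifs with h1 h2 h2
    · rfl
    · rfl
    · symm; apply hA.2; rw [Fin.lt_def]; omega
    · rfl
  have hunit : IsUnit (Jk k t * A * Jk k t - Imn k k t) := by
    apply isUnit_of_mul_one (B := Jk k t * B * Jk k t - Imn k k t)
    have e2 : Jk k t * (A * (Jk k t * (B * Jk k t))) = Jk k t := by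
      rw [hJ hB, ← Matrix.mul_assoc A, hAB, Matrix.one_mul, Jk_Jk _ _ h]
    simp only [Matrix.mul_sub, Matrix.sub_mul, Matrix.mul_assoc, e2, Imn_Jk_assoc h, Jk_Imn _ _ _ h,
      Imn_mul _ _ _ _ h, zero_add, add_zero, Jk_Jk_assoc h, Matrix.mul_zero]
    rw [Jk_eq]
    abel
  refine ⟨((isUnit_permMat _).mul hunit).mul (isUnit_permMat _), fun i j hij => ?_⟩
  have hne : ¬ ((u⁻¹ i : Fin k) : ℕ) = (u⁻¹ j : Fin k) :=
    fun h5 => absurd (u⁻¹.injective (Fin.ext h5)) hij.ne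
  rw [conj_apply, Matrix.sub_apply, mul_Jk_apply, Jk_mul_apply]
  simp only [Imn]
  split_ifs with h1 h2 h2
  · omega
  · rw [sub_zero]
    apply hA.2
    by_contra h3
    rcases eq_or_lt_of_le (not_lt.1 h3) with h4 | h4
    · have := u⁻¹.injective h4
      exact hij.ne' this
    · have := hu _ _ h4 h1
      simp at this
      exact absurd hij (not_lt.2 this.le)
  all_goals first
    | (exfalso; omega)
    | simp

/-! ### First inclusion -/

theorem CR_subset {m n t : ℕ} (htm : t ≤ m) (htn : t ≤ n)
    {y : Equiv.Perm (Fin m)} {v : Equiv.Perm (Fin n)}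
    {z : Equiv.Perm (Fin m)} {u : Equiv.Perm (Fin n)}
    (hy : tailMono t y) (hv : headMono t v) (hz : headMono t z) (hu : tailMono t u)
    {w : Equiv.Perm (Fin (m+n))} (hw : permMat (m+n) w = wBlock m n t y v z u) :
    CRset m n t y z u v ⊆ Pset m n w := by
  rintro x ⟨c, ⟨g, ⟨⟨b1, hb1, b2, hb2, hg⟩, φ, hφ, hg'⟩, rfl⟩, r,
    ⟨h, ⟨⟨d1, hd1, d2, hd2, hh⟩, e, he, hh'⟩, rfl⟩, rfl⟩
  obtain ⟨b1i, hb1i, hb11, hb11'⟩ := Bp_inv hb1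
  obtain ⟨b2i, hb2i, hb22, hb22'⟩ := Bp_inv hb2
  obtain ⟨d1i, hd1i, hd11, hd11'⟩ := Bm_inv hd1
  obtain ⟨φi, hφi, hφφ, hφφ'⟩ := Bm_inv hφ
  have hp := (Bp_head htm hb2 hb2i hb22).1
  have hpi := (Bm_head htn hd1i hd1 hd11').1
  set p := Imn t m t * b2 * Imn m t t with hpdef
  set pi' := Imn t n t * d1i * Imn n t t with hpidef
  -- rewriting rules
  have vv : ∀ {l : ℕ} (X : Mat n l), permMat n v⁻¹ * (permMat n v * X) = X := by
    intro l X
    rw [← Matrix.mul_assoc, permMat_inv_mul, Matrix.one_mul]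
  have zz : ∀ {l : ℕ} (X : Mat m l), permMat m z⁻¹ * (permMat m z * X) = X := by
    intro l X
    rw [← Matrix.mul_assoc, permMat_inv_mul, Matrix.one_mul]
  have yy : ∀ {l : ℕ} (X : Mat m l), permMat m y⁻¹ * (permMat m y * X) = X := by
    intro l X
    rw [← Matrix.mul_assoc, permMat_inv_mul, Matrix.one_mul]
  have bb1 : ∀ {l : ℕ} (X : Mat m l), b1i * (b1 * X) = X := by
    intro l X
    rw [← Matrix.mul_assoc, hb11', Matrix.one_mul]
  have bb2 : ∀ {l : ℕ} (X : Mat m l), b2i * (b2 * X) = X := by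
    intro l X
    rw [← Matrix.mul_assoc, hb22', Matrix.one_mul]
  have ff : ∀ {l : ℕ} (X : Mat m l), φi * (φ * X) = X := by
    intro l X
    rw [← Matrix.mul_assoc, hφφ', Matrix.one_mul]
  -- inverse of g
  have hgi : permMat m z⁻¹ * φi = b2i * (permMat m y⁻¹ * b1i) := by
    have e1 : (permMat m z⁻¹ * φi) * g = 1 := by
      rw [hg']
      simp only [Matrix.mul_assoc, ff, permMat_inv_mul]
    have e2 : (b2i * (permMat m y⁻¹ * b1i)) * g = 1 := by
      rw [hg]
      simp only [Matrix.mul_assoc, bb1, yy, hb22']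
    have e3 := mul_eq_one_comm.1 e2
    calc permMat m z⁻¹ * φi = (permMat m z⁻¹ * φi) * (g * (b2i * (permMat m y⁻¹ * b1i))) := by
          rw [e3, Matrix.mul_one]
      _ = _ := by rw [← Matrix.mul_assoc, e1, Matrix.one_mul]
  have hpid : pi' * (Imn t n t * d1) = Imn t n t := by
    have hB' : Imn t n t * (d1i * Imn n n t) = Imn t n t * d1i := by
      ext i j
      simp only [Imn_mul_apply htn, mul_Imn_apply htn, i.2, dite_true]
      split_ifs with hi
      · rfl
      · symm; apply hd1i.2; rw [Fin.lt_def]; simp only; omega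
    rw [hpidef]
    simp only [Matrix.mul_assoc, Imn_mul_assoc _ (le_refl t)]
    rw [← Matrix.mul_assoc d1i, ← Matrix.mul_assoc, hB', Matrix.mul_assoc, hd11', Matrix.mul_one]
  refine mem_Pset_of hw
    (Bi := permMat m y * (Imn m m t + Jk m t * b2i) * permMat m y⁻¹ * b1i)
    (D := permMat n u * (Jk n t * d1 * Jk n t - Imn n n t) * permMat n u⁻¹ * d2)
    (e := permMat n v * (Imn n t t * p * Imn t n t + Jk n t) * permMat n v⁻¹ * e)
    (f := permMat m z * (Imn m t t * pi' * Imn t m t + Jk m t) * permMat m z⁻¹ * φi)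
    (q := Imn n m t * (permMat m y⁻¹ * b1i) +
      Jk n t * (d1 * (Imn n t t * (pi' * (Imn t m t * (permMat m z⁻¹ * φi))))))
    (Bp_mul (tail_conj_Bp htm hy hb2i) hb1i) (Bm_mul (tail_conj_Bm htn hu hd1) hd2)
    (Bp_mul (head_conj_Bp htn hv hp) he) (Bm_mul (head_conj_Bm htm hz hpi) hφi) ?_ ?_ ?_
  · rw [hg, hh']
    simp only [Matrix.mul_assoc, Matrix.add_mul, Matrix.mul_add, bb1, yy, bb2, vv,
      Imn_mul_assoc _ htn, Imn_Jk_assoc htn, Jk_Imn_assoc htm, Imn_mul_assoc _ htm, hpdef,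
      Matrix.mul_zero, add_zero, Imn_mul_assoc _ (le_refl t)]
  · simp only [Matrix.mul_assoc, Matrix.add_mul, Matrix.mul_add, zz, 
      Imn_mul_assoc _ htn, Imn_Jk_assoc htn, Jk_Imn_assoc htm, Jk_Jk_assoc htm,
      Matrix.mul_zero, add_zero, zero_add, hgi]
  · have hx : permMat m z⁻¹ * (φi * (g * (Imn m n t * h))) = Imn m n t * h := by
      rw [hg']
      simp only [Matrix.mul_assoc, ff, zz]
    have hhe : permMat n v⁻¹ * e = h := hh'.symm
    simp only [Matrix.mul_assoc, Matrix.add_mul, Matrix.mul_add, zz, vv, hx,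
      Imn_mul_assoc _ htn, Imn_mul_assoc _ htm, Imn_mul_assoc _ (le_refl t),
      Imn_Jk_assoc htn, Imn_Jk_assoc htm, Jk_Imn_assoc htm, Jk_Imn_assoc htn, Jk_Jk_assoc htm,
      Jk_Jk_assoc htn,
      Matrix.mul_zero, add_zero, zero_add, hhe]
    rw [hh]
    have e1 : ∀ {l : ℕ} (X : Mat n l), pi' * (Imn t n t * (d1 * X)) = Imn t n t * X := by
      intro l X
      rw [← Matrix.mul_assoc (Imn t n t), ← Matrix.mul_assoc, hpid]
    simp only [Matrix.mul_assoc, e1, Imn_mul_assoc _ (le_refl t)]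
    simp only [← Matrix.mul_assoc, ← Matrix.sub_mul, ← Matrix.add_mul, ← Matrix.mul_sub]
    congr 3
    simp only [Jk_eq, Matrix.mul_assoc, Matrix.sub_mul, Matrix.mul_sub, Matrix.mul_one,
      Matrix.one_mul, Matrix.mul_add, Imn_mul _ _ _ _ htn]
    abel

/-! ### LU factorizations -/

/-- the principal submatrix on the indices `< i` -/
def lead {R : Type*} {k : ℕ} (A : Matrix (Fin k) (Fin k) R) (i : Fin k) :
    Matrix {a : Fin k // a < i} {a : Fin k // a < i} R :=
  A.submatrix Subtype.val Subtype.val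

theorem sum_lt_eq {R : Type*} [AddCommMonoid R] {k : ℕ} (i : Fin k) (f : Fin k → R)
    (hf : ∀ a, ¬ a < i → f a = 0) : ∑ a : {a : Fin k // a < i}, f a.1 = ∑ a, f a := by
  rw [← Finset.sum_subtype (Finset.univ.filter (fun a => a < i)) (by simp) f, Finset.sum_filter]
  refine Finset.sum_congr rfl fun a _ => ?_
  split_ifs with h
  · rfl
  · exact (hf a h).symm

theorem exists_LU {R : Type*} [CommRing R] {k : ℕ} (A : Matrix (Fin k) (Fin k) R)
    (hA : ∀ i, IsUnit (lead A i).det) :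
    ∃ L L' U : Matrix (Fin k) (Fin k) R, (∀ i j, i < j → L' i j = 0) ∧ (∀ i, L' i i = 1) ∧
      L * L' = 1 ∧ (∀ i j, j < i → U i j = 0) ∧ A = L * U := by
  have row : ∀ i : Fin k, ∃ r : Fin k → R, (∀ j, i < j → r j = 0) ∧ r i = 1 ∧
      ∀ j, j < i → ∑ a, r a * A a j = 0 := by
    intro i
    set ρ : {a : Fin k // a < i} → R :=
      Matrix.vecMul (fun a => - A i a.1) (lead A i)⁻¹ with hρ
    have hρ2 : Matrix.vecMul ρ (lead A i) = fun a => - A i a.1 := by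
      rw [hρ, Matrix.vecMul_vecMul, Matrix.nonsing_inv_mul _ (hA i), Matrix.vecMul_one]
    refine ⟨fun a => if h : a < i then ρ ⟨a, h⟩ else if a = i then 1 else 0, ?_, ?_, ?_⟩
    · intro j hj
      simp [not_lt.2 hj.le, hj.ne']
    · simp
    · intro j hj
      have h1 := congrFun hρ2 ⟨j, hj⟩
      simp only [Matrix.vecMul, dotProduct, lead, Matrix.submatrix_apply] at h1
      have h2 : ∀ a : Fin k, (if h : a < i then ρ ⟨a, h⟩ else if a = i then 1 else 0) * A a j =
          (if h : a < i then ρ ⟨a, h⟩ * A a j else 0) + (if a = i then A a j else 0) := by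
        intro a
        split_ifs with h3 h4 h4
        · exact absurd h4 h3.ne
        · simp
        · simp
        · simp
      rw [Finset.sum_congr rfl (fun a _ => h2 a), Finset.sum_add_distrib]
      simp only [Finset.sum_ite_eq', Finset.mem_univ, if_true]
      rw [← sum_lt_eq i]
      · have h3 : ∑ a : {a : Fin k // a < i},
            (if h : a.1 < i then ρ ⟨a.1, h⟩ * A a.1 j else 0) = - A i j := by
          rw [← h1]
          refine Finset.sum_congr rfl fun a _ => ?_
          rw [dif_pos a.2]
        rw [h3, neg_add_cancel]
      · intro a ha
        rw [dif_neg ha]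
  choose r hr0 hr1 hrA using row
  have hdet : (Matrix.of r).det = 1 := by
    rw [Matrix.det_of_isLowerTriangular (Matrix.of r) (fun i j hij => hr0 i j hij)]
    simp [hr1]
  refine ⟨(Matrix.of r).adjugate, Matrix.of r, Matrix.of r * A, hr0, hr1, ?_, ?_, ?_⟩
  · rw [Matrix.adjugate_mul, hdet, one_smul]
  · intro i j hij
    exact hrA i j hij
  · rw [← Matrix.mul_assoc, Matrix.adjugate_mul, hdet, one_smul, Matrix.one_mul]

theorem lead_mul_left {k : ℕ} {P Q : Mat k k} (hP : ∀ i j, i < j → P i j = 0) (i : Fin k) :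
    lead (P * Q) i = lead P i * lead Q i := by
  ext a b
  simp only [lead, Matrix.submatrix_apply, Matrix.mul_apply]
  rw [sum_lt_eq i (fun c => P a c * Q c b)]
  intro c hc
  rw [hP a c (lt_of_lt_of_le a.2 (not_lt.1 hc)), zero_mul]

theorem lead_mul_right {k : ℕ} {P Q : Mat k k} (hQ : ∀ i j, j < i → Q i j = 0) (i : Fin k) :
    lead (P * Q) i = lead P i * lead Q i := by
  ext a b
  simp only [lead, Matrix.submatrix_apply, Matrix.mul_apply]
  rw [sum_lt_eq i (fun c => P a c * Q c b)]
  intro c hc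
  rw [hQ c b (lt_of_lt_of_le b.2 (not_lt.1 hc)), mul_zero]

theorem lead_one {k : ℕ} (i : Fin k) : lead (1 : Mat k k) i = 1 := by
  ext a b
  simp [lead, Matrix.one_apply, Subtype.ext_iff]

theorem lead_LU {k : ℕ} {L U : Mat k k} (hL : L ∈ Bm k) (hU : U ∈ Bp k) (i : Fin k) :
    (lead (L * U) i).det ≠ 0 := by
  obtain ⟨L', hL', h1, _⟩ := Bm_inv hL
  obtain ⟨U', hU', _, h2⟩ := Bp_inv hU
  have e1 := congrArg (fun M => (lead M i).det) h1
  have e2 := congrArg (fun M => (lead M i).det) h2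
  simp only [lead_mul_left hL.2, lead_mul_right hU.2, lead_one, Matrix.det_mul,
    Matrix.det_one] at e1 e2 ⊢
  exact mul_ne_zero (left_ne_zero_of_mul_eq_one e1) (right_ne_zero_of_mul_eq_one e2)

/-- LU over `ℂ` for an invertible matrix. -/
theorem exists_LU_complex {k : ℕ} (A : Mat k k) (hA : ∀ i, (lead A i).det ≠ 0) (hu : IsUnit A) :
    ∃ L ∈ Bm k, (∃ L' ∈ Bm k, L * L' = 1 ∧ ∀ i, L' i i = 1) ∧
      (∀ i, L i i = 1) ∧ ∃ U ∈ Bp k, A = L * U := by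
  obtain ⟨L, L', U, h1, h2, h3, h4, h5⟩ := exists_LU A (fun i => (hA i).isUnit)
  have hL'u : IsUnit L' := isUnit_of_mul_one (mul_eq_one_comm.1 h3)
  have hL' : L' ∈ Bm k := ⟨hL'u, h1⟩
  obtain ⟨B, hB, hB1, hB2⟩ := Bm_inv hL'
  have : L = B := by
    calc L = L * (L' * B) := by rw [hB1, Matrix.mul_one]
      _ = B := by rw [← Matrix.mul_assoc, h3, Matrix.one_mul]
  subst this
  have hd : ∀ i, L i i = 1 := by
    intro i
    have h6 := congrFun (congrFun h3 i) i
    rw [Matrix.mul_apply, Finset.sum_eq_single i, h2, mul_one, Matrix.one_apply_eq] at h6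
    · exact h6
    · intro a _ ha
      rcases lt_or_gt_of_ne ha with h | h
      · rw [h1 a i h, mul_zero]
      · rw [hB.2 i a h, zero_mul]
    · simp
  refine ⟨L, hB, ⟨L', hL', h3, h2⟩, hd, U, ⟨?_, h4⟩, h5⟩
  have : L' * A = U := by rw [h5, ← Matrix.mul_assoc, hB1, Matrix.one_mul]
  rw [← this]
  exact hL'u.mul hu

/-- A matrix triangular for some ordering of the indices, with unit diagonal. -/
theorem det_one_of_order {ι : Type*} [Fintype ι] [DecidableEq ι] {k : ℕ} (f : ι → Fin k)
    (hf : Function.Injective f) (M : Matrix ι ι ℂ) (h0 : ∀ a b, f a < f b → M a b = 0)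
    (h1 : ∀ a, M a a = 1) : M.det = 1 := by
  let _ : LinearOrder ι := LinearOrder.lift' f hf
  rw [Matrix.det_of_isLowerTriangular _ (fun i j hij => h0 i j hij)]
  simp [h1]

/-- `z L z⁻¹ = β φ` for unipotent lower triangular `L`. -/
theorem exists_UL_conj {k : ℕ} (z : Equiv.Perm (Fin k)) {L : Mat k k} (hL : L ∈ Bm k)
    (h1 : ∀ i, L i i = 1) :
    ∃ β ∈ Bp k, ∃ φ ∈ Bm k, permMat k z * L * permMat k z⁻¹ = β * φ := by
  set σ : Equiv.Perm (Fin k) := revP k * z with hσ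
  obtain ⟨P, hP, -, -, U, hU, h⟩ := exists_LU_complex (permMat k σ * L * permMat k σ⁻¹) (by
    intro i
    rw [det_one_of_order (fun a : {a : Fin k // a < i} => σ⁻¹ a.1)
      (σ⁻¹.injective.comp Subtype.val_injective)]
    · exact one_ne_zero
    · intro a b hab
      simp only [lead, Matrix.submatrix_apply, conj_apply]
      exact hL.2 _ _ hab
    · intro a
      simp only [lead, Matrix.submatrix_apply, conj_apply]
      exact h1 _) (((isUnit_permMat _).mul hL.1).mul (isUnit_permMat _))
  refine ⟨_, revconj_Bp hP, _, revconj_Bm hU, ?_⟩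
  have rr : ∀ {k l : ℕ} (X : Mat k l), permMat k (revP k) * (permMat k (revP k) * X) = X := by
    intro k l X
    rw [← Matrix.mul_assoc, rev_mul_rev, Matrix.one_mul]
  have h' : permMat k (revP k) * (permMat k σ * L * permMat k σ⁻¹) * permMat k (revP k) =
      permMat k (revP k) * (P * U) * permMat k (revP k) := by rw [h]
  have e1 : permMat k σ = permMat k (revP k) * permMat k z := by rw [permMat_mul]
  have e2 : permMat k σ⁻¹ = permMat k z⁻¹ * permMat k (revP k) := by
    rw [permMat_mul, hσ, _root_.mul_inv_rev, revP_inv]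
  rw [e1, e2] at h'
  simp only [Matrix.mul_assoc, rr, rev_mul_rev, Matrix.mul_one] at h' ⊢
  exact h'

/-! ### The generic points of `Pset` lie in `CRset` -/

theorem sub_Bm {k t : ℕ} (h : t ≤ k) {v : Equiv.Perm (Fin k)} (hv : headMono t v)
    {A : Mat k k} (hA : A ∈ Bm k) :
    Imn t k t * (permMat k v⁻¹ * (A * (permMat k v * Imn k t t))) ∈ Bm t := by
  have hent : ∀ i j : Fin t, (Imn t k t * (permMat k v⁻¹ * (A * (permMat k v * Imn k t t)))) i j =
      A (v (Fin.castLE h i)) (v (Fin.castLE h j)) := by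
    intro i j
    rw [Imn_mul_apply h, dif_pos i.2, permMat_mul_apply, ← Matrix.mul_assoc, mul_Imn_apply h,
      dif_pos j.2, mul_permMat_apply, inv_inv]
    rfl
  have hlow : ∀ i j : Fin t, i < j →
      (Imn t k t * (permMat k v⁻¹ * (A * (permMat k v * Imn k t t)))) i j = 0 := by
    intro i j hij
    rw [hent]
    apply hA.2
    apply hv
    · exact hij
    · exact j.2
  refine ⟨?_, hlow⟩
  have hdA : ∏ i, A i i ≠ 0 := by
    rw [← Matrix.det_of_isLowerTriangular A (fun i j hij => hA.2 i j hij)]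
    exact ((Matrix.isUnit_iff_isUnit_det A).1 hA.1).ne_zero
  rw [Matrix.isUnit_iff_isUnit_det, Matrix.det_of_isLowerTriangular _ (fun i j hij => hlow i j hij)]
  refine IsUnit.mk0 _ (Finset.prod_ne_zero_iff.2 fun i _ => ?_)
  rw [hent]
  exact Finset.prod_ne_zero_iff.1 hdA _ (Finset.mem_univ _)

theorem Imn_transpose (a b t : ℕ) : (Imn a b t)ᵀ = Imn b a t := by
  ext i j
  simp only [Matrix.transpose_apply, Imn]
  congr 1
  apply propext
  constructor
  · rintro ⟨h1, h2⟩; exact ⟨h1.symm, by omega⟩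
  · rintro ⟨h1, h2⟩; exact ⟨h1.symm, by omega⟩

theorem sub_Bp {k t : ℕ} (h : t ≤ k) {v : Equiv.Perm (Fin k)} (hv : headMono t v)
    {A : Mat k k} (hA : A ∈ Bp k) :
    Imn t k t * (permMat k v⁻¹ * (A * (permMat k v * Imn k t t))) ∈ Bp t := by
  rw [← Bm_transpose]
  have := sub_Bm h hv (Bm_transpose.2 hA)
  simp only [Matrix.transpose_mul, Imn_transpose, permMat_transpose, inv_inv, Matrix.mul_assoc]
  exact this

/-- The matrix whose leading minors detect the generic points. -/
def testMat (m n t : ℕ) (z : Equiv.Perm (Fin m)) (v : Equiv.Perm (Fin n)) (x : Mat m n) : Mat t t :=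
  Imn t m t * (permMat m z⁻¹ * (x * (permMat n v * Imn n t t)))

theorem testMat_apply {m n t : ℕ} (htm : t ≤ m) (htn : t ≤ n) (z : Equiv.Perm (Fin m))
    (v : Equiv.Perm (Fin n)) (x : Mat m n) (i j : Fin t) :
    testMat m n t z v x i j = x (z (Fin.castLE htm i)) (v (Fin.castLE htn j)) := by
  rw [testMat, Imn_mul_apply htm, dif_pos i.2, permMat_mul_apply, ← Matrix.mul_assoc,
    mul_Imn_apply htn, dif_pos j.2, mul_permMat_apply, inv_inv]
  rfl

theorem testMat_of_CR {m n t : ℕ} (htm : t ≤ m) (htn : t ≤ n)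
    {y : Equiv.Perm (Fin m)} {v : Equiv.Perm (Fin n)}
    {z : Equiv.Perm (Fin m)} {u : Equiv.Perm (Fin n)}
    (hv : headMono t v) (hz : headMono t z) {x : Mat m n} (hx : x ∈ CRset m n t y z u v)
    (i : Fin t) : (lead (testMat m n t z v x) i).det ≠ 0 := by
  obtain ⟨c, ⟨g, ⟨-, φ, hφ, rfl⟩, rfl⟩, r, ⟨h, ⟨-, e, he, rfl⟩, rfl⟩, rfl⟩ := hx
  have := lead_LU (sub_Bm htm hz hφ) (sub_Bp htn hv he) i
  simp only [Matrix.mul_assoc] at this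
  simpa only [testMat, Matrix.mul_assoc] using this

theorem CR_of_generic {m n t : ℕ} (htm : t ≤ m) (htn : t ≤ n)
    {y : Equiv.Perm (Fin m)} {v : Equiv.Perm (Fin n)}
    {z : Equiv.Perm (Fin m)} {u : Equiv.Perm (Fin n)}
    (hv : headMono t v) (hz : headMono t z)
    {w : Equiv.Perm (Fin (m+n))} (hw : permMat (m+n) w = wBlock m n t y v z u)
    {x : Mat m n} (hx : x ∈ Pset m n w)
    (hgen : ∀ i, (lead (testMat m n t z v x) i).det ≠ 0) :
    x ∈ CRset m n t y z u v := by
  obtain ⟨Bi, hBi, D, hD, e, he, f, hf, q, h1, h2, h3⟩ := exists_of_mem_Pset hw hx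
  obtain ⟨b, hb, hbb, hbb'⟩ := Bp_inv hBi
  obtain ⟨φ, hφ, hfφ, hφf⟩ := Bm_inv hf
  obtain ⟨Di, hDi, hDD, hDD'⟩ := Bm_inv hD
  -- cancellation rules
  have vv : ∀ {l : ℕ} (X : Mat n l), permMat n v⁻¹ * (permMat n v * X) = X := by
    intro l X
    rw [← Matrix.mul_assoc, permMat_inv_mul, Matrix.one_mul]
  have vv2 : ∀ {l : ℕ} (X : Mat n l), permMat n v * (permMat n v⁻¹ * X) = X := by
    intro l X
    rw [← Matrix.mul_assoc, permMat_mul_inv, Matrix.one_mul]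
  have uu : ∀ {l : ℕ} (X : Mat n l), permMat n u⁻¹ * (permMat n u * X) = X := by
    intro l X
    rw [← Matrix.mul_assoc, permMat_inv_mul, Matrix.one_mul]
  have zz : ∀ {l : ℕ} (X : Mat m l), permMat m z⁻¹ * (permMat m z * X) = X := by
    intro l X
    rw [← Matrix.mul_assoc, permMat_inv_mul, Matrix.one_mul]
  have zz2 : ∀ {l : ℕ} (X : Mat m l), permMat m z * (permMat m z⁻¹ * X) = X := by
    intro l X
    rw [← Matrix.mul_assoc, permMat_mul_inv, Matrix.one_mul]
  have yy : ∀ {l : ℕ} (X : Mat m l), permMat m y⁻¹ * (permMat m y * X) = X := by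
    intro l X
    rw [← Matrix.mul_assoc, permMat_inv_mul, Matrix.one_mul]
  have yy2 : ∀ {l : ℕ} (X : Mat m l), permMat m y * (permMat m y⁻¹ * X) = X := by
    intro l X
    rw [← Matrix.mul_assoc, permMat_mul_inv, Matrix.one_mul]
  have bb : ∀ {l : ℕ} (X : Mat m l), b * (Bi * X) = X := by
    intro l X
    rw [← Matrix.mul_assoc, hbb', Matrix.one_mul]
  have bb2 : ∀ {l : ℕ} (X : Mat m l), Bi * (b * X) = X := by
    intro l X
    rw [← Matrix.mul_assoc, hbb, Matrix.one_mul]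
  have ff : ∀ {l : ℕ} (X : Mat m l), f * (φ * X) = X := by
    intro l X
    rw [← Matrix.mul_assoc, hfφ, Matrix.one_mul]
  have ff2 : ∀ {l : ℕ} (X : Mat m l), φ * (f * X) = X := by
    intro l X
    rw [← Matrix.mul_assoc, hφf, Matrix.one_mul]
  have dd : ∀ {l : ℕ} (X : Mat n l), D * (Di * X) = X := by
    intro l X
    rw [← Matrix.mul_assoc, hDD, Matrix.one_mul]
  set T : Mat m m := Imn m n t * (q * (φ * permMat m z)) + Jk m t with hT
  set S : Mat m m := permMat m z⁻¹ * (f * (b * permMat m y)) with hS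
  have hT2 : permMat m y⁻¹ * (Bi * (φ * permMat m z)) = T := by
    rw [hT]
    conv_lhs => rw [h2]
    simp only [Matrix.mul_assoc, yy, Matrix.add_mul, ff, permMat_inv_mul, Matrix.mul_one]
  have hTS : T * S = 1 := by
    rw [← hT2, hS]
    simp only [Matrix.mul_assoc, zz2, ff2, bb2, permMat_inv_mul]
  have hST : S * T = 1 := mul_eq_one_comm.1 hTS
  have hJT : Jk m t * T = Jk m t := by
    rw [hT, Matrix.mul_add, Jk_Imn_assoc htm, Jk_Jk _ _ htm, zero_add]
  have hJS : Jk m t * S = Jk m t := by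
    conv_lhs => rw [← hJT, Matrix.mul_assoc, hTS, Matrix.mul_one]
  have hred : ∀ M : Mat m m, Jk m t * M = Jk m t →
      M * Imn m t t = Imn m t t * (Imn t m t * (M * Imn m t t)) := by
    intro M hM
    have h4 : Jk m t * (M * Imn m t t) = 0 := by
      rw [← Matrix.mul_assoc, hM, Jk_Imn _ _ _ htm]
    rw [Jk_eq, Matrix.sub_mul, Matrix.one_mul, sub_eq_zero] at h4
    rw [Imn_mul_assoc _ (le_refl t)]
    exact h4
  set a : Mat t t := Imn t m t * (S * Imn m t t) with ha
  set p : Mat t t := Imn t m t * (T * Imn m t t) with hp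
  have hSI : S * Imn m t t = Imn m t t * a := hred S hJS
  have hTI : T * Imn m t t = Imn m t t * p := hred T hJT
  have hpa : p * a = 1 := by
    rw [hp, Matrix.mul_assoc, Matrix.mul_assoc, ← hSI, ← Matrix.mul_assoc T, hTS, Matrix.one_mul,
      Imn_mul _ _ _ _ htm, Imn_one]
  have hby : b * permMat m y = φ * (permMat m z * S) := by
    rw [hS]
    simp only [zz2, ff2]
  have hIs : Imn m n t = Imn m t t * Imn t n t := (Imn_mul _ _ _ _ (le_refl t)).symm
  have hxa : x = φ * (permMat m z * (Imn m t t * (a * (Imn t n t * (permMat n v⁻¹ * e))))) := by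
    calc x = b * (Bi * x) := (bb x).symm
      _ = (b * permMat m y) * (Imn m t t * (Imn t n t * (permMat n v⁻¹ * e))) := by
          rw [h1, hIs]; simp only [Matrix.mul_assoc]
      _ = φ * (permMat m z * ((S * Imn m t t) * (Imn t n t * (permMat n v⁻¹ * e)))) := by
          rw [hby]; simp only [Matrix.mul_assoc]
      _ = _ := by rw [hSI]; simp only [Matrix.mul_assoc]
  have hΦ := sub_Bm htm hz hφ
  have hΨ := sub_Bp htn hv he
  set Φ := Imn t m t * (permMat m z⁻¹ * (φ * (permMat m z * Imn m t t))) with hΦd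
  set Ψ := Imn t n t * (permMat n v⁻¹ * (e * (permMat n v * Imn n t t))) with hΨd
  have htest : testMat m n t z v x = Φ * a * Ψ := by
    rw [hxa, hΦd, hΨd]
    simp only [testMat, Matrix.mul_assoc]
  have hau : IsUnit a := isUnit_of_mul_one (mul_eq_one_comm.1 hpa)
  obtain ⟨L, hL, -, -, U, hU, hLU⟩ := exists_LU_complex _ hgen (by
    rw [htest]; exact (hΦ.1.mul hau).mul hΨ.1)
  obtain ⟨Φi, hΦi, -, hΦΦ⟩ := Bm_inv hΦ
  obtain ⟨Ψi, hΨi, hΨΨ, -⟩ := Bp_inv hΨ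
  have hl := Bm_mul hΦi hL
  have hr := Bp_mul hU hΨi
  have halr : a = (Φi * L) * (U * Ψi) := by
    have h5 : Φi * (Φ * a * Ψ) * Ψi = Φi * (L * U) * Ψi := by rw [← htest, hLU]
    calc a = (Φi * Φ) * a * (Ψ * Ψi) := by rw [hΦΦ, hΨΨ, Matrix.one_mul, Matrix.mul_one]
      _ = Φi * (Φ * a * Ψ) * Ψi := by simp only [Matrix.mul_assoc]
      _ = _ := by rw [h5]; simp only [Matrix.mul_assoc]
  generalize Φi * L = l at hl halr
  generalize U * Ψi = r at hr halr
  obtain ⟨ri, hri, hrr, hrr'⟩ := Bp_inv hr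
  have hpl : p * l = ri := by
    calc p * l = p * l * (r * ri) := by rw [hrr, Matrix.mul_one]
      _ = (p * (l * r)) * ri := by simp only [Matrix.mul_assoc]
      _ = ri := by rw [← halr, hpa, Matrix.one_mul]
  refine ⟨φ * (permMat m z * (Imn m t t * l * Imn t m t + Jk m t)) * Imn m t t,
    ⟨φ * (permMat m z * (Imn m t t * l * Imn t m t + Jk m t)), ⟨⟨b, hb,
      T * (Imn m t t * l * Imn t m t + Jk m t), ?_, ?_⟩,
      φ * (permMat m z * (Imn m t t * l * Imn t m t + Jk m t) * permMat m z⁻¹),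
      Bm_mul hφ (head_conj_Bm htm hz hl), ?_⟩, rfl⟩,
    Imn t n t * ((Imn n t t * r * Imn t n t + Jk n t) * (permMat n v⁻¹ * e)),
    ⟨(Imn n t t * r * Imn t n t + Jk n t) * (permMat n v⁻¹ * e), ⟨?_,
      (permMat n v * (Imn n t t * r * Imn t n t + Jk n t) * permMat n v⁻¹) * e,
      Bp_mul (head_conj_Bp htn hv hr) he, ?_⟩, rfl⟩, ?_⟩
  · refine ⟨(isUnit_of_mul_one hTS).mul (isUnit_IAI htm hl.1), ?_⟩
    have h6 : T * (Imn m t t * l * Imn t m t + Jk m t) =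
        Imn m t t * (ri * Imn t m t) + T * Jk m t := by
      rw [Matrix.mul_add, ← Matrix.mul_assoc, ← Matrix.mul_assoc, hTI, Matrix.mul_assoc _ p, hpl,
        Matrix.mul_assoc]
    intro i j hij
    have hij' : (j : ℕ) < i := hij
    rw [h6, Matrix.add_apply, mul_Jk_apply, Imn_mul_apply (le_refl t)]
    by_cases hj : (j : ℕ) < t
    · rw [if_neg (not_le.2 hj), add_zero]
      split_ifs with hi
      · rw [mul_Imn_apply (le_refl t), dif_pos hj]
        exact hri.2 _ _ hij
      · rfl
    · rw [if_pos (not_lt.1 hj), dif_neg (by omega), zero_add, hT, Matrix.add_apply,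
        Imn_mul_apply htn, dif_neg (by omega), zero_add, Jk, if_neg (by omega)]
  · have h7 : b * permMat m y * T = φ * permMat m z := by
      rw [hby]
      simp only [Matrix.mul_assoc, hST, Matrix.mul_one]
    rw [← Matrix.mul_assoc _ T, h7, Matrix.mul_assoc φ]
  · simp only [Matrix.mul_assoc, permMat_inv_mul, Matrix.mul_one]
  · set Q : Mat n t := q * (φ * (permMat m z * Imn m t t)) with hQ
    set Λ : Mat n n := Jk n t - (Jk n t * Q + Imn n t t) * (l * Imn t n t) with hΛ
    have h8 : permMat n u⁻¹ * D =
        (Jk n t - (Jk n t * Q + Imn n t t) * (a * Imn t n t)) * (permMat n v⁻¹ * e) := by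
      rw [h3, hxa, hQ]
      simp only [Matrix.mul_assoc, uu, Matrix.add_mul, Matrix.sub_mul, ff, zz,
        Imn_mul_assoc _ htm]
    have h9 : Λ * (Imn n t t * r * Imn t n t + Jk n t) =
        Jk n t - (Jk n t * Q + Imn n t t) * (a * Imn t n t) := by
      rw [hΛ, halr]
      simp only [Matrix.mul_assoc, Matrix.add_mul, Matrix.sub_mul, Matrix.mul_add,
        Jk_Imn_assoc htn, Jk_Jk _ _ htn, Imn_mul_assoc _ htn, Imn_Jk _ _ _ htn, Imn_one,
        Matrix.one_mul, Matrix.mul_zero, add_zero, zero_sub, zero_add]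
      abel
    have h10 : Λ * ((Imn n t t * r * Imn t n t + Jk n t) * (permMat n v⁻¹ * e)) =
        permMat n u⁻¹ * D := by
      rw [← Matrix.mul_assoc, h9, h8]
    have hΛB : Λ ∈ Bm n := by
      refine ⟨isUnit_of_mul_one (B := (Imn n t t * r * Imn t n t + Jk n t) * (permMat n v⁻¹ * e) *
        (Di * permMat n u)) ?_, ?_⟩
      · rw [← Matrix.mul_assoc, h10]
        simp only [Matrix.mul_assoc, dd, permMat_inv_mul]
      · intro i j hij
        have hij' : (i : ℕ) < j := hij
        rw [hΛ, Matrix.sub_apply, ← Matrix.mul_assoc, mul_Imn_apply (le_refl t), Jk,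
          if_neg (by omega), zero_sub, neg_eq_zero]
        split_ifs with hj
        · rw [Matrix.add_mul, Matrix.add_apply, Matrix.mul_assoc, Jk_mul_apply,
            if_neg (by omega), zero_add, Imn_mul_apply (le_refl t), dif_pos (by omega)]
          exact hl.2 _ _ hij
        · rfl
    obtain ⟨Λi, hΛi, -, hΛΛ⟩ := Bm_inv hΛB
    refine ⟨Λi, hΛi, D, hD, ?_⟩
    rw [Matrix.mul_assoc Λi, ← h10, ← Matrix.mul_assoc Λi, hΛΛ, Matrix.one_mul]
  · simp only [Matrix.mul_assoc, vv]
  · conv_lhs => rw [hxa, halr]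
    simp only [Matrix.mul_assoc, Matrix.add_mul, Matrix.mul_add, Jk_Imn_assoc htm,
      Imn_mul_assoc _ htm, Imn_mul_assoc _ htn, Imn_Jk_assoc htn, Imn_one, Matrix.one_mul,
      Matrix.mul_zero, add_zero]

/-! ### Nonemptiness -/

theorem exists_match_list {k : ℕ} {l₁ l₂ : List (Fin k)} (h : List.Forall₂ (· ≤ ·) l₁ l₂)
    (h1 : l₁.Nodup) (h2 : l₂.Nodup) :
    ∃ τ : Fin k → Fin k, (∀ a ∈ l₁, τ a ∈ l₂ ∧ a ≤ τ a) ∧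
      ∀ a ∈ l₁, ∀ b ∈ l₁, τ a = τ b → a = b := by
  induction h with
  | nil => exact ⟨id, by simp, by simp⟩
  | @cons a b l₁ l₂ hab _ ih =>
    rw [List.nodup_cons] at h1 h2
    obtain ⟨τ, hτ1, hτ2⟩ := ih h1.2 h2.2
    refine ⟨fun c => if c = a then b else τ c, ?_, ?_⟩
    · intro c hc
      by_cases hca : c = a
      · subst hca
        simp [hab]
      · have hc' : c ∈ l₁ := by simpa [hca] using hc
        simp only [hca, if_false]
        exact ⟨List.mem_cons_of_mem _ (hτ1 c hc').1, (hτ1 c hc').2⟩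
    · intro c hc d hd hcd
      by_cases hca : c = a <;> by_cases hda : d = a
      · rw [hca, hda]
      · have hd' : d ∈ l₁ := by simpa [hda] using hd
        simp only [hca, hda, if_true, if_false] at hcd
        exact absurd (hcd ▸ (hτ1 d hd').1) h2.1
      · have hc' : c ∈ l₁ := by simpa [hca] using hc
        simp only [hca, hda, if_true, if_false] at hcd
        exact absurd (hcd ▸ (hτ1 c hc').1) h2.1
      · have hd' : d ∈ l₁ := by simpa [hda] using hd
        have hc' : c ∈ l₁ := by simpa [hca] using hc
        simp only [hca, hda, if_false] at hcd
        exact hτ2 c hc' d hd' hcd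

theorem exists_match {k : ℕ} {A B : Finset (Fin k)} (h : finsetLE A B) :
    ∃ τ : Fin k → Fin k, (∀ a ∈ A, τ a ∈ B ∧ a ≤ τ a) ∧
      ∀ a ∈ A, ∀ b ∈ A, τ a = τ b → a = b := by
  obtain ⟨τ, h1, h2⟩ := exists_match_list h (Finset.sort_nodup _ _) (Finset.sort_nodup _ _)
  exact ⟨τ, by simpa using h1, by simpa using h2⟩

theorem exists_sigma {k : ℕ} {z y : Equiv.Perm (Fin k)} (h : bruhatLE z y) (i : Fin k) :
    ∃ σ : Equiv.Perm {a : Fin k // a < i}, ∀ a, z a.1 ≤ y (σ a).1 := by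
  by_cases hi : (i : ℕ) = 0
  · have : IsEmpty {a : Fin k // a < i} := ⟨fun a => by
      have := a.2
      rw [Fin.lt_def] at this
      omega⟩
    exact ⟨1, fun a => this.elim a⟩
  · let p : Fin k := ⟨(i : ℕ) - 1, by omega⟩
    have hp : ∀ a : Fin k, a ≤ p ↔ a < i := by
      intro a
      rw [Fin.le_def, Fin.lt_def]
      simp only [p]
      omega
    obtain ⟨τ, h1, h2⟩ := exists_match (h p)
    have hm : ∀ a : {a : Fin k // a < i}, z a.1 ∈ (Finset.Iic p).image z := fun a =>
      Finset.mem_image_of_mem _ (Finset.mem_Iic.2 ((hp _).2 a.2))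
    have hm2 : ∀ a : {a : Fin k // a < i}, y.symm (τ (z a.1)) < i := by
      intro a
      obtain ⟨c, hc, hc'⟩ := Finset.mem_image.1 (h1 _ (hm a)).1
      rw [← hc', Equiv.symm_apply_apply]
      exact (hp c).1 (Finset.mem_Iic.1 hc)
    let s : {a : Fin k // a < i} → {a : Fin k // a < i} := fun a => ⟨y.symm (τ (z a.1)), hm2 a⟩
    have hs : Function.Injective s := by
      intro a b hab
      have h3 := congrArg Subtype.val hab
      simp only [s] at h3
      exact Subtype.ext (z.injective (h2 _ (hm a) _ (hm b) (y.symm.injective h3)))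
    refine ⟨Equiv.ofBijective s (Finite.injective_iff_bijective.1 hs), fun a => ?_⟩
    simp only [Equiv.ofBijective_apply, s, Equiv.apply_symm_apply]
    exact (h1 _ (hm a)).2

/-- the generic upper triangular matrix -/
def genUp (k : ℕ) : Matrix (Fin k) (Fin k) (MvPolynomial (Fin k × Fin k) ℂ) :=
  fun i j => if j < i then 0 else MvPolynomial.X (i, j)

theorem genUp_minor_ne {k : ℕ} {z y : Equiv.Perm (Fin k)} (h : bruhatLE z y) (i : Fin k) :
    (lead ((genUp k).submatrix z y) i).det ≠ 0 := by
  obtain ⟨σ, hσ⟩ := exists_sigma h i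
  intro h0
  let pt : Fin k × Fin k → ℂ := fun q => if ∃ a, q.1 = z a.1 ∧ q.2 = y (σ a).1 then 1 else 0
  have h1 := congrArg (MvPolynomial.eval pt) h0
  rw [RingHom.map_det, map_zero] at h1
  have h2 : (MvPolynomial.eval pt).mapMatrix (lead ((genUp k).submatrix z y) i) =
      σ.permMatrix ℂ := by
    ext a c
    simp only [RingHom.mapMatrix_apply, Matrix.map_apply, lead, Matrix.submatrix_apply, genUp,
      Equiv.Perm.permMatrix, PEquiv.toMatrix_apply, Equiv.toPEquiv_apply, Option.mem_def,
      Option.some.injEq]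
    by_cases hac : σ a = c
    · subst hac
      rw [if_neg (not_lt.2 (hσ a)), if_pos rfl, MvPolynomial.eval_X]
      exact if_pos ⟨a, rfl, rfl⟩
    · rw [if_neg hac]
      split_ifs with h3
      · simp
      · rw [MvPolynomial.eval_X]
        refine if_neg ?_
        rintro ⟨b, hb1, hb2⟩
        have e1 : a = b := Subtype.ext (z.injective hb1)
        have e2 : c = σ b := Subtype.ext (y.injective hb2)
        exact hac (e1 ▸ e2.symm)
  rw [h2, Matrix.det_permutation] at h1
  have h4 := (Equiv.Perm.sign σ).isUnit.ne_zero
  exact h4 (by exact_mod_cast h1)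

theorem exists_generic {k : ℕ} {z y : Equiv.Perm (Fin k)} (h : bruhatLE z y) :
    ∃ b ∈ Bp k, ∀ i, (lead (permMat k z⁻¹ * b * permMat k y) i).det ≠ 0 := by
  have hF : (∏ i, (lead ((genUp k).submatrix z y) i).det) *
      ∏ i : Fin k, (MvPolynomial.X (i, i) : MvPolynomial (Fin k × Fin k) ℂ) ≠ 0 :=
    mul_ne_zero (Finset.prod_ne_zero_iff.2 fun i _ => genUp_minor_ne h i)
      (Finset.prod_ne_zero_iff.2 fun i _ => MvPolynomial.X_ne_zero _)
  have hex : ∃ pt : Fin k × Fin k → ℂ, MvPolynomial.eval pt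
      ((∏ i, (lead ((genUp k).submatrix z y) i).det) *
      ∏ i : Fin k, (MvPolynomial.X (i, i) : MvPolynomial (Fin k × Fin k) ℂ)) ≠ 0 := by
    by_contra hcon
    push Not at hcon
    exact hF (MvPolynomial.funext fun pt => by rw [hcon pt, map_zero])
  obtain ⟨pt, hpt⟩ := hex
  rw [map_mul, map_prod, map_prod] at hpt
  have hp1 := Finset.prod_ne_zero_iff.1 (left_ne_zero_of_mul hpt)
  have hp2 := right_ne_zero_of_mul hpt
  simp only [MvPolynomial.eval_X] at hp2
  let b : Mat k k := fun i j => if j < i then 0 else pt (i, j)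
  have hup : ∀ i j : Fin k, j < i → b i j = 0 := fun i j hij => if_pos hij
  refine ⟨b, ⟨?_, hup⟩, fun i => ?_⟩
  · rw [Matrix.isUnit_iff_isUnit_det, Matrix.det_of_isUpperTriangular (fun i j hij => hup i j hij)]
    simpa [b] using hp2
  · have h1 := hp1 i (Finset.mem_univ _)
    rw [RingHom.map_det] at h1
    have h2 : (MvPolynomial.eval pt).mapMatrix (lead ((genUp k).submatrix z y) i) =
        lead (permMat k z⁻¹ * b * permMat k y) i := by
      ext a c
      simp only [RingHom.mapMatrix_apply, Matrix.map_apply, lead, Matrix.submatrix_apply, genUp,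
        mul_permMat_apply, permMat_mul_apply, inv_inv]
      simp only [b]
      split_ifs
      · simp
      · simp
    rwa [h2] at h1

theorem exists_cell {k : ℕ} {z y : Equiv.Perm (Fin k)} (h : bruhatLE z y) :
    ∃ g, g ∈ dcPlus (permMat k y) ∧ ∃ b ∈ Bm k, g = b * permMat k z := by
  obtain ⟨b, hb, hgen⟩ := exists_generic h
  obtain ⟨L, hL, -, hL1, U, hU, hLU⟩ := exists_LU_complex _ hgen
    (((isUnit_permMat _).mul hb.1).mul (isUnit_permMat _))
  obtain ⟨β, hβ, φ, hφ, hβφ⟩ := exists_UL_conj z hL hL1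
  obtain ⟨βi, hβi, -, hβi1⟩ := Bp_inv hβ
  obtain ⟨Ui, hUi, hUi1, -⟩ := Bp_inv hU
  refine ⟨φ * permMat k z, ⟨βi * b, Bp_mul hβi hb, Ui, hUi, ?_⟩, φ, hφ, rfl⟩
  have h1 : b * permMat k y = β * φ * permMat k z * U := by
    calc b * permMat k y = permMat k z * (permMat k z⁻¹ * b * permMat k y) := by
          rw [Matrix.mul_assoc (permMat k z⁻¹), ← Matrix.mul_assoc, permMat_mul_inv, Matrix.one_mul]
      _ = permMat k z * L * (permMat k z⁻¹ * permMat k z) * U := by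
          rw [hLU, permMat_inv_mul, Matrix.mul_one, Matrix.mul_assoc]
      _ = _ := by rw [← hβφ]; simp only [Matrix.mul_assoc]
  calc φ * permMat k z = (βi * β) * (φ * permMat k z) * (U * Ui) := by
        rw [hβi1, hUi1, Matrix.one_mul, Matrix.mul_one]
    _ = βi * (β * φ * permMat k z * U) * Ui := by simp only [Matrix.mul_assoc]
    _ = _ := by rw [← h1]; simp only [Matrix.mul_assoc]

theorem CR_nonempty {m n t : ℕ}
    {y : Equiv.Perm (Fin m)} {v : Equiv.Perm (Fin n)}
    {z : Equiv.Perm (Fin m)} {u : Equiv.Perm (Fin n)}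
    (hzy : bruhatLE z y) (hvu : bruhatLE v u) : ∃ x, x ∈ CRset m n t y z u v := by
  obtain ⟨g, hg1, hg2⟩ := exists_cell hzy
  obtain ⟨h, ⟨b1, hb1, b2, hb2, hh⟩, φ, hφ, hh'⟩ := exists_cell hvu
  refine ⟨_, _, ⟨g, ⟨hg1, hg2⟩, rfl⟩, _, ⟨hᵀ, ⟨⟨b2ᵀ, Bm_transpose.2 hb2, b1ᵀ, Bm_transpose.2 hb1, ?_⟩,
    φᵀ, Bp_transpose.2 hφ, ?_⟩, rfl⟩, rfl⟩
  · rw [hh]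
    simp only [Matrix.transpose_mul, permMat_transpose, Matrix.mul_assoc]
  · rw [hh', Matrix.transpose_mul, permMat_transpose]

/-! ### Irreducibility of `Pset` -/

theorem blk_transpose (m n : ℕ) (A : Mat n n) (B : Mat n m) (C : Mat m n) (D : Mat m m) :
    (blk m n A B C D)ᵀ = blk m n Aᵀ Cᵀ Bᵀ Dᵀ := by
  rw [blk, Matrix.transpose_reindex, Matrix.fromBlocks_transpose]
  rfl

theorem blk_Bm {m n : ℕ} {A : Mat n n} {B : Mat n m} {C : Mat m n} {D : Mat m m} :
    blk m n A B C D ∈ Bm (m+n) ↔ A ∈ Bm n ∧ D ∈ Bm m ∧ B = 0 := by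
  rw [← Bp_transpose, blk_transpose, blk_Bp, Bp_transpose, Bp_transpose, Matrix.transpose_eq_zero]

/-- the coordinates extracted from an LU factorization -/
def xf {R : Type*} [CommRing R] (m n : ℕ) (L' L : Matrix (Fin (m+n)) (Fin (m+n)) R) :
    Matrix (Fin m) (Fin n) R := fun i j =>
  ∑ k : Fin m, L' (fe m n (Sum.inr (Fin.rev i))) (fe m n (Sum.inr k)) *
    L (fe m n (Sum.inr k)) (fe m n (Sum.inl j))

theorem xf_blk {m n : ℕ} (A : Mat n n) (B : Mat n m) (C : Mat m n) (D : Mat m m)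
    (A' : Mat n n) (B' : Mat n m) (C' : Mat m n) (D' : Mat m m) :
    xf m n (blk m n A' B' C' D') (blk m n A B C D) = permMat m (revP m) * (D' * C) := by
  ext i j
  rw [permMat_mul_apply, Matrix.mul_apply]
  simp only [xf, blk, Matrix.reindex_apply, Matrix.submatrix_apply, Equiv.symm_apply_apply,
    Matrix.fromBlocks_apply₂₂, Matrix.fromBlocks_apply₂₁]
  rfl

def Wp (m n : ℕ) : Mat (m+n) (m+n) := blk m n (permMat n (revP n)) 0 0 (permMat m (revP m))

theorem Wp_mul_Wp (m n : ℕ) : Wp m n * Wp m n = 1 := by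
  rw [Wp, blk_mul]
  simp only [rev_mul_rev, Matrix.zero_mul, Matrix.mul_zero, add_zero, zero_add, blk_one]

theorem Wp_mul_emb (m n : ℕ) (x : Mat m n) :
    Wp m n * embMat m n x = blk m n 1 0 (permMat m (revP m) * x) 1 := by
  rw [Wp, embMat_eq, blk_mul]
  simp only [rev_mul_rev, Matrix.zero_mul, Matrix.mul_zero, add_zero, zero_add]

theorem one_Bm (k : ℕ) : (1 : Mat k k) ∈ Bm k :=
  ⟨isUnit_one, fun i j hij => Matrix.one_apply_ne hij.ne⟩

theorem nu_Bm (m n : ℕ) (x : Mat m n) : Wp m n * embMat m n x ∈ Bm (m+n) := by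
  rw [Wp_mul_emb, blk_Bm]
  exact ⟨one_Bm _, one_Bm _, rfl⟩

theorem xf_mem {m n : ℕ} {w : Equiv.Perm (Fin (m+n))} {M L L' U : Mat (m+n) (m+n)}
    (hM : M ∈ Bp (m+n)) (hU : U ∈ Bp (m+n)) (hL : L ∈ Bm (m+n)) (hL' : L' ∈ Bm (m+n))
    (h1 : L * L' = 1) (h : Wp m n * M * permMat (m+n) w = L * U) :
    xf m n L' L ∈ Pset m n w := by
  obtain ⟨A, B, C, D, rfl⟩ := exists_blk L
  obtain ⟨A', B', C', D', rfl⟩ := exists_blk L'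
  obtain ⟨hA, hD, rfl⟩ := blk_Bm.1 hL
  obtain ⟨hA', hD', rfl⟩ := blk_Bm.1 hL'
  rw [xf_blk]
  rw [blk_mul, ← blk_one] at h1
  obtain ⟨e1, -, e3, e4⟩ := blk_inj h1
  simp only [Matrix.zero_mul, Matrix.mul_zero, add_zero, zero_add] at e1 e4
  have e1' := mul_eq_one_comm.1 e1
  have e4' := mul_eq_one_comm.1 e4
  obtain ⟨Ui, hUi, hU1, -⟩ := Bp_inv hU
  have rr : ∀ {k l : ℕ} (X : Mat k l), permMat k (revP k) * (permMat k (revP k) * X) = X := by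
    intro k l X
    rw [← Matrix.mul_assoc, rev_mul_rev, Matrix.one_mul]
  have hβ : blk m n (permMat n (revP n) * A' * permMat n (revP n)) 0 0
      (permMat m (revP m) * D' * permMat m (revP m)) ∈ Bp (m+n) :=
    blk_Bp.2 ⟨revconj_Bp hA', revconj_Bp hD', rfl⟩
  refine ⟨_, Bp_mul hβ hM, Ui, hUi, ?_⟩
  have h5 : M * permMat (m+n) w * Ui = Wp m n * blk m n A 0 C D := by
    calc M * permMat (m+n) w * Ui = (Wp m n * Wp m n) * M * permMat (m+n) w * Ui := by
          rw [Wp_mul_Wp, Matrix.one_mul]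
      _ = Wp m n * (Wp m n * M * permMat (m+n) w) * Ui := by simp only [Matrix.mul_assoc]
      _ = Wp m n * blk m n A 0 C D * (U * Ui) := by rw [h]; simp only [Matrix.mul_assoc]
      _ = _ := by rw [hU1, Matrix.mul_one]
  rw [Matrix.mul_assoc _ M, Matrix.mul_assoc _ (M * _), h5, Wp, blk_mul, blk_mul, embMat_eq]
  simp only [Matrix.zero_mul, Matrix.mul_zero, add_zero, zero_add, Matrix.mul_assoc, rr, e1', e4',
    Matrix.mul_one]

theorem eq_one_of_uni {k : ℕ} {A : Mat k k} (h1 : A ∈ Bp k) (h2 : A ∈ Bm k)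
    (h3 : ∀ i, A i i = 1) : A = 1 := by
  ext i j
  rcases lt_trichotomy i j with h | h | h
  · rw [h2.2 i j h, Matrix.one_apply_ne h.ne]
  · subst h
    rw [h3, Matrix.one_apply_eq]
  · rw [h1.2 i j h, Matrix.one_apply_ne h.ne']

theorem xf_eq {m n : ℕ} {w : Equiv.Perm (Fin (m+n))} {x : Mat m n} {b c L L' U : Mat (m+n) (m+n)}
    (hc : c ∈ Bp (m+n)) (hU : U ∈ Bp (m+n)) (hL' : L' ∈ Bm (m+n))
    (hd : ∀ i, L' i i = 1) (h1 : L * L' = 1) (h : Wp m n * b * permMat (m+n) w = L * U)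
    (hx : embMat m n x = b * permMat (m+n) w * c) : xf m n L' L = x := by
  have h1' := mul_eq_one_comm.1 h1
  have h2 : L' * (Wp m n * embMat m n x) = U * c := by
    calc L' * (Wp m n * embMat m n x) = L' * (Wp m n * b * permMat (m+n) w) * c := by
          rw [hx]; simp only [Matrix.mul_assoc]
      _ = (L' * L) * (U * c) := by rw [h]; simp only [Matrix.mul_assoc]
      _ = _ := by rw [h1', Matrix.one_mul]
  have h3 := Bp_mul hU hc
  rw [← h2, Wp_mul_emb] at h3
  obtain ⟨A, B, C, D, rfl⟩ := exists_blk L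
  obtain ⟨A', B', C', D', rfl⟩ := exists_blk L'
  obtain ⟨hA', hD', rfl⟩ := blk_Bm.1 hL'
  rw [blk_mul, blk_Bp] at h3
  obtain ⟨i1, i2, i3⟩ := h3
  simp only [Matrix.zero_mul, Matrix.mul_zero, add_zero, zero_add, Matrix.mul_one] at i1 i2 i3
  have hA1 : A' = 1 := eq_one_of_uni i1 hA' (fun i => by
    have := hd (fe m n (Sum.inl i))
    simpa [blk] using this)
  have hD1 : D' = 1 := eq_one_of_uni i2 hD' (fun i => by
    have := hd (fe m n (Sum.inr i))
    simpa [blk] using this)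
  subst hA1 hD1
  rw [blk_mul, ← blk_one] at h1
  obtain ⟨-, -, e3, e4⟩ := blk_inj h1
  simp only [Matrix.mul_zero, zero_add, Matrix.mul_one] at e3 e4
  subst e4
  rw [Matrix.one_mul] at e3 i3
  rw [xf_blk, Matrix.one_mul]
  have e5 : C = permMat m (revP m) * x := by
    rw [add_comm] at i3
    have := add_left_cancel (a := C') (b := C) (c := permMat m (revP m) * x)
      (by rw [add_comm C' C, e3, add_comm, i3])
    exact this
  rw [e5, ← Matrix.mul_assoc, rev_mul_rev, Matrix.one_mul]

theorem lead_map {R S : Type*} {k : ℕ} (A : Matrix (Fin k) (Fin k) R) (g : R → S) (i : Fin k) :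
    lead (A.map g) i = (lead A i).map g := rfl

theorem lead_det_map {R S : Type*} [CommRing R] [CommRing S] {k : ℕ}
    (A : Matrix (Fin k) (Fin k) R) (g : R →+* S) (i : Fin k) :
    (lead (A.map g) i).det = g (lead A i).det := by
  rw [lead_map, RingHom.map_det]
  rfl

theorem xf_map {R S : Type*} [CommRing R] [CommRing S] {m n : ℕ}
    (L' L : Matrix (Fin (m+n)) (Fin (m+n)) R) (g : R →+* S) :
    xf m n (L'.map g) (L.map g) = (xf m n L' L).map g := by
  ext i j
  simp [xf]

open Polynomial in
/-- Elements of `ℂ[X]_f` are determined by their evaluations. -/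
theorem loc_zero (f : ℂ[X]) (hf : f ≠ 0) (r : Localization.Away f)
    (h : ∀ (s : ℂ) (hs : IsUnit (evalRingHom s f)), IsLocalization.Away.lift f hs r = 0) :
    r = 0 := by
  obtain ⟨k, p, hp⟩ := IsLocalization.Away.surj f r
  have hpz : p * f = 0 := by
    apply Polynomial.funext
    intro s
    rw [eval_mul, eval_zero]
    by_cases hs : eval s f = 0
    · rw [hs, mul_zero]
    · have hs' : IsUnit (evalRingHom s f) := by
        rw [coe_evalRingHom]; exact IsUnit.mk0 _ hs
      have h1 := congrArg (IsLocalization.Away.lift f hs') hp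
      rw [map_mul, h s hs', zero_mul, IsLocalization.Away.lift_eq, coe_evalRingHom] at h1
      rw [← h1, zero_mul]
  have hp0 : p = 0 := (mul_eq_zero.1 hpz).resolve_right hf
  rw [hp0, map_zero] at hp
  have hu : IsUnit (algebraMap ℂ[X] (Localization.Away f) f ^ k) :=
    (IsLocalization.Away.algebraMap_isUnit f).pow k
  exact (hu.mul_left_eq_zero).1 hp

open Polynomial in
theorem Pset_irred {m n : ℕ} {w : Equiv.Perm (Fin (m+n))}
    (p h : MvPolynomial (Fin m × Fin n) ℂ)
    (hph : ∀ x ∈ Pset m n w, MvPolynomial.eval (fun q => x q.1 q.2) h ≠ 0 →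
      MvPolynomial.eval (fun q => x q.1 q.2) p = 0)
    {x1 : Mat m n} (hx1 : x1 ∈ Pset m n w)
    (hh : MvPolynomial.eval (fun q => x1 q.1 q.2) h ≠ 0)
    {x0 : Mat m n} (hx0 : x0 ∈ Pset m n w) :
    MvPolynomial.eval (fun q => x0 q.1 q.2) p = 0 := by
  obtain ⟨b0, hb0, c0, hc0, hE0⟩ := hx0
  obtain ⟨b1, hb1, c1, hc1, hE1⟩ := hx1
  let M : Matrix (Fin (m+n)) (Fin (m+n)) ℂ[X] :=
    fun i j => (1 - X) * C (b0 i j) + X * C (b1 i j)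
  let A : Matrix (Fin (m+n)) (Fin (m+n)) ℂ[X] :=
    (Wp m n).map C * M * (permMat (m+n) w).map C
  let f : ℂ[X] := (∏ i, (lead A i).det) * M.det
  have hMs : ∀ s : ℂ, ∀ i j, (M.map (evalRingHom s)) i j = (1 - s) * b0 i j + s * b1 i j := by
    intro s i j
    rw [Matrix.map_apply]
    simp [M]
    ring
  have hAs : ∀ s : ℂ, A.map (evalRingHom s) =
      Wp m n * M.map (evalRingHom s) * permMat (m+n) w := by
    intro s
    simp only [A, Matrix.map_mul]
    congr 2
    · congr 1
      ext i j
      simp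
    · ext i j
      simp
  have hM0 : M.map (evalRingHom 0) = b0 := by
    ext i j
    rw [hMs]; simp
  have hM1 : M.map (evalRingHom 1) = b1 := by
    ext i j
    rw [hMs]; simp
  have hfs : ∀ s, evalRingHom s f =
      (∏ i, (lead (A.map (evalRingHom s)) i).det) * (M.map (evalRingHom s)).det := by
    intro s
    simp only [f]
    rw [map_mul, map_prod]
    simp only [lead_det_map]
    congr 1
    rw [RingHom.map_det]
    rfl
  -- nonvanishing criterion
  have key : ∀ (s : ℂ) (b c : Mat (m+n) (m+n)) (x : Mat m n), M.map (evalRingHom s) = b →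
      b ∈ Bp (m+n) → c ∈ Bp (m+n) →
      embMat m n x = b * permMat (m+n) w * c → IsUnit (evalRingHom s f) := by
    intro s b c x hMb hb hc hE
    obtain ⟨ci, hci, hcc, -⟩ := Bp_inv hc
    refine IsUnit.mk0 _ ?_
    rw [hfs, hAs, hMb]
    refine mul_ne_zero (Finset.prod_ne_zero_iff.2 fun i _ => ?_)
      ((Matrix.isUnit_iff_isUnit_det b).1 hb.1).ne_zero
    have e : Wp m n * b * permMat (m+n) w = (Wp m n * embMat m n x) * ci := by
      rw [hE]
      simp only [Matrix.mul_assoc, hcc, Matrix.mul_one]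
    rw [e]
    exact lead_LU (nu_Bm m n x) hci i
  have hf0 := key 0 b0 c0 x0 hM0 hb0 hc0 hE0
  have hf1 := key 1 b1 c1 x1 hM1 hb1 hc1 hE1
  have hf : f ≠ 0 := by
    intro hf
    rw [hf, map_zero] at hf0
    exact not_isUnit_zero hf0
  -- the factorization over the localization
  let R := Localization.Away f
  have hdom : IsDomain R :=
    IsLocalization.isDomain_localization (powers_le_nonZeroDivisors_of_noZeroDivisors hf)
  let ι : ℂ[X] →+* R := algebraMap ℂ[X] (Localization.Away f)
  have hιf : IsUnit (ι f) := IsLocalization.Away.algebraMap_isUnit f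
  obtain ⟨L, L', U, hL'0, hL'1, hLL, hU0, hLU⟩ := exists_LU (A.map ι) (by
    intro i
    rw [lead_det_map]
    refine isUnit_of_dvd_unit ?_ hιf
    apply _root_.map_dvd
    exact Dvd.dvd.mul_right (Finset.dvd_prod_of_mem _ (Finset.mem_univ i)) _)
  -- evaluation
  have hev : ∀ (s : ℂ) (hs : IsUnit (evalRingHom s f)) (ev : R →+* ℂ),
      ev = IsLocalization.Away.lift f hs →
      (∀ q : ℂ[X], ev (ι q) = eval s q) ∧
      M.map (evalRingHom s) ∈ Bp (m+n) ∧ U.map ev ∈ Bp (m+n) ∧ L.map ev ∈ Bm (m+n) ∧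
      L'.map ev ∈ Bm (m+n) ∧ (∀ i, (L'.map ev) i i = 1) ∧ L.map ev * L'.map ev = 1 ∧
      Wp m n * M.map (evalRingHom s) * permMat (m+n) w = L.map ev * U.map ev := by
    intro s hs ev hev
    have h1 : ∀ q : ℂ[X], ev (ι q) = eval s q := by
      intro q
      rw [hev]
      exact IsLocalization.Away.lift_eq f hs q
    have h2 : (A.map ι).map ev = A.map (evalRingHom s) := by
      ext i j
      simp only [Matrix.map_apply, h1, coe_evalRingHom]
    have hMd : IsUnit (M.map (evalRingHom s)) := by
      rw [Matrix.isUnit_iff_isUnit_det]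
      rw [hfs] at hs
      exact isUnit_of_mul_isUnit_right hs
    have h3 : L.map ev * L'.map ev = 1 := by
      rw [← Matrix.map_mul, hLL, Matrix.map_one _ (map_zero _) (map_one _)]
    have h4 : Wp m n * M.map (evalRingHom s) * permMat (m+n) w = L.map ev * U.map ev := by
      rw [← Matrix.map_mul, ← hLU, h2, hAs]
    have hL'B : L'.map ev ∈ Bm (m+n) := by
      refine ⟨isUnit_of_mul_one (mul_eq_one_comm.1 h3), fun i j hij => ?_⟩
      rw [Matrix.map_apply, hL'0 i j hij, map_zero]
    have hLB : L.map ev ∈ Bm (m+n) := by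
      obtain ⟨Q, hQ, hQ1, hQ2⟩ := Bm_inv hL'B
      have : L.map ev = Q := by
        calc L.map ev = L.map ev * (L'.map ev * Q) := by rw [hQ1, Matrix.mul_one]
          _ = Q := by rw [← Matrix.mul_assoc, h3, Matrix.one_mul]
      rw [this]
      exact hQ
    refine ⟨h1, ⟨hMd, fun i j hij => ?_⟩, ⟨?_, fun i j hij => ?_⟩, hLB, hL'B, fun i => ?_, h3, h4⟩
    · rw [hMs, hb0.2 i j hij, hb1.2 i j hij, mul_zero, mul_zero, add_zero]
    · have hWu : IsUnit (Wp m n) := isUnit_of_mul_one (Wp_mul_Wp m n)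
      have h5 : U.map ev = L'.map ev * (Wp m n * M.map (evalRingHom s) * permMat (m+n) w) := by
        rw [h4, ← Matrix.mul_assoc, mul_eq_one_comm.1 h3, Matrix.one_mul]
      rw [h5]
      exact hL'B.1.mul ((hWu.mul hMd).mul (isUnit_permMat _))
    · rw [Matrix.map_apply, hU0 i j hij, map_zero]
    · rw [Matrix.map_apply, hL'1 i, map_one]
  let xR : Fin m × Fin n → R := fun q => xf m n L' L q.1 q.2
  let ψ : MvPolynomial (Fin m × Fin n) ℂ → R := fun P => MvPolynomial.eval₂ (ι.comp C) xR P
  have hψ : ∀ (s : ℂ) (hs : IsUnit (evalRingHom s f)) (P : MvPolynomial (Fin m × Fin n) ℂ),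
      (IsLocalization.Away.lift f hs : R →+* ℂ) (ψ P) =
        MvPolynomial.eval (fun q => xf m n (L'.map (IsLocalization.Away.lift f hs : R →+* ℂ))
          (L.map (IsLocalization.Away.lift f hs : R →+* ℂ)) q.1 q.2) P := by
    intro s hs P
    obtain ⟨h1, -⟩ := hev s hs _ rfl
    simp only [ψ]
    rw [MvPolynomial.hom_eval₂, xf_map, MvPolynomial.eval]
    have : (IsLocalization.Away.lift f hs : R →+* ℂ).comp (ι.comp C) = RingHom.id ℂ := by
      ext a
      simp only [RingHom.comp_apply, h1, eval_C, RingHom.id_apply]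
    rw [this]
    rfl
  have hprod : ψ p * ψ h = 0 := by
    apply loc_zero f hf
    intro s hs
    obtain ⟨h1, h2, h3, h4, h5, h6, h7, h8⟩ := hev s hs _ rfl
    have hmem := xf_mem h2 h3 h4 h5 h7 h8
    rw [map_mul]
    rw [hψ s hs p, hψ s hs h]
    by_cases hz : MvPolynomial.eval (fun q =>
      xf m n (L'.map (IsLocalization.Away.lift f hs : R →+* ℂ))
          (L.map (IsLocalization.Away.lift f hs : R →+* ℂ)) q.1 q.2) h = 0
    · rw [hz, mul_zero]
    · rw [hph _ hmem hz, zero_mul]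
  have hψh : ψ h ≠ 0 := by
    intro hz
    have h9 := hψ 1 hf1 h
    obtain ⟨h1, h2, h3, h4, h5, h6, h7, h8⟩ := hev 1 hf1 _ rfl
    rw [hM1] at h8
    rw [hz, map_zero, xf_eq hc1 h3 h5 h6 h7 h8 hE1] at h9
    exact hh h9.symm
  have hψp : ψ p = 0 := (mul_eq_zero.1 hprod).resolve_right hψh
  have h9 := hψ 0 hf0 p
  obtain ⟨h1, h2, h3, h4, h5, h6, h7, h8⟩ := hev 0 hf0 _ rfl
  rw [hM0] at h8
  rw [hψp, map_zero, xf_eq hc0 h3 h5 h6 h7 h8 hE0] at h9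
  exact h9.symm

theorem statement14 (m n t : ℕ) (hm : 0 < m) (hn : 0 < n) (htm : t ≤ m) (htn : t ≤ n)
    (y : Equiv.Perm (Fin m)) (v : Equiv.Perm (Fin n))
    (z : Equiv.Perm (Fin m)) (u : Equiv.Perm (Fin n))
    (hy : tailMono t y) (hv : headMono t v) (hz : headMono t z) (hu : tailMono t u)
    (hzy : bruhatLE z y) (hvu : bruhatLE v u)
    (w : Equiv.Perm (Fin (m+n))) (hw : permMat (m+n) w = wBlock m n t y v z u) :
    CRset m n t y z u v ⊆ Pset m n w ∧
    Pset m n w ⊆ zClosure (CRset m n t y z u v) ∧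
    zClosure (Pset m n w) = zClosure (CRset m n t y z u v) := by
  have h1 := CR_subset htm htn hy hv hz hu hw
  have h2 : Pset m n w ⊆ zClosure (CRset m n t y z u v) := by
    intro x hx p hp
    obtain ⟨x1, hx1⟩ := CR_nonempty (t := t) hzy hvu
    let G : Matrix (Fin t) (Fin t) (MvPolynomial (Fin m × Fin n) ℂ) := fun i j =>
      MvPolynomial.X (z (Fin.castLE htm i), v (Fin.castLE htn j))
    have hG : ∀ x : Mat m n, MvPolynomial.eval (fun q => x q.1 q.2) (∏ i, (lead G i).det) =
        ∏ i, (lead (testMat m n t z v x) i).det := by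
      intro x
      rw [map_prod]
      refine Finset.prod_congr rfl fun i _ => ?_
      rw [← lead_det_map]
      congr 2
      ext i j
      rw [testMat_apply htm htn]
      rw [Matrix.map_apply]
      simp [G]
    refine Pset_irred p (∏ i, (lead G i).det) ?_ (h1 hx1) ?_ hx
    · intro x' hx' hne
      rw [hG] at hne
      exact hp x' (CR_of_generic htm htn hv hz hw hx'
        (fun i => Finset.prod_ne_zero_iff.1 hne i (Finset.mem_univ i)))
    · rw [hG]
      exact Finset.prod_ne_zero_iff.2 fun i _ => testMat_of_CR htm htn hv hz hx1 i
  refine ⟨h1, h2, Set.Subset.antisymm ?_ ?_⟩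
  · intro x hx p hp
    exact hx p (fun y' hy' => h2 hy' p hp)
  · intro x hx p hp
    exact hx p (fun y' hy' => hp y' (h1 hy'))
end
end

section
/- Let n be a positive integer, 0 ≤ t ≤ n, and let c = (c_1 < c_2 < ⋯ < c_t) be a strictly increasing sequence in {1,…,n}. Define R^n_c = {a ∈ M_{t,n}(ℂ) : a_{i,c_i} ≠ 0 for i = 1,…,t, and a_{i,j} = 0 whenever j < c_i}, and Σ^{t,n}_c = {(u,v) ∈ S_n^{S²_{n−t}} × S_n^{S¹_t} : v ≤ u in the Bruhat order and v(i) = c_i for i = 1,…,t}. Then R^n_c is the union over (u,v) ∈ Σ^{t,n}_c of the sets I^{t,n}_t·(B_n⁻ u⁻¹ B_n⁻ ∩ v⁻¹·B_n⁺), and these sets are pairwise disjoint. -/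
open Matrix

noncomputable section

/-- the row-echelon variety R^n_c -/
def Rnc (n t : ℕ) (c : Fin t → Fin n) : Set (Mat t n) :=
  {a | (∀ i : Fin t, a i (c i) ≠ 0) ∧ ∀ (i : Fin t) (j : Fin n), j < c i → a i j = 0}


/-! ### Leading positions -/

/-- `j` is the first position where `x` is nonzero. -/
def LeadAt {J : Type*} [LinearOrder J] (x : J → ℂ) (j : J) : Prop :=
  x j ≠ 0 ∧ ∀ k, k < j → x k = 0

/-- `x` is a combination of the rows of `g` with index `< p`. -/
def Fl {m : ℕ} {J : Type*} (g : Matrix (Fin m) J ℂ) (p : ℕ) : Set (J → ℂ) :=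
  {x | ∃ y : Fin m → ℂ, (∀ i : Fin m, p ≤ (i:ℕ) → y i = 0) ∧ x = y ᵥ* g}

theorem exists_leadAt {J : Type*} [LinearOrder J] [Finite J] (x : J → ℂ) (hx : x ≠ 0) :
    ∃ j, LeadAt x j := by
  obtain ⟨j, hj⟩ := Function.ne_iff.mp hx
  have hne : {j | x j ≠ 0}.Nonempty := ⟨j, hj⟩
  obtain ⟨i, hi, hmin⟩ := Set.exists_min_image {j | x j ≠ 0} id (Set.toFinite _) hne
  refine ⟨i, hi, fun k hk => ?_⟩
  by_contra h
  exact absurd (hmin k h) (not_le.mpr hk)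

theorem coeff_zero {m : ℕ} {J : Type*} [LinearOrder J] (g : Matrix (Fin m) J ℂ)
    (w : Fin m → J) (hw : Function.Injective w) (hg : ∀ i, LeadAt (g i) (w i))
    (L : Set J) (hL : IsLowerSet L) (y : Fin m → ℂ) (hy : ∀ j ∈ L, (y ᵥ* g) j = 0) :
    ∀ i, w i ∈ L → y i = 0 := by
  by_contra hcon
  push Not at hcon
  obtain ⟨i0, hi0, hy0⟩ := hcon
  have hne : {i | w i ∈ L ∧ y i ≠ 0}.Nonempty := ⟨i0, hi0, hy0⟩
  obtain ⟨i, ⟨hi, hyi⟩, hmin⟩ := Set.exists_min_image {i | w i ∈ L ∧ y i ≠ 0} w (Set.toFinite _) hne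
  have h1 : (y ᵥ* g) (w i) = y i * g i (w i) := by
    simp only [Matrix.vecMul, dotProduct]
    apply Finset.sum_eq_single i
    · intro k _ hk
      rcases lt_trichotomy (w k) (w i) with h | h | h
      · have : y k = 0 := by
          by_contra hne
          exact absurd (hmin k ⟨hL h.le hi, hne⟩) (not_le.mpr h)
        simp [this]
      · exact absurd (hw h) hk
      · rw [(hg k).2 _ h, mul_zero]
    · simp
  rw [hy _ hi] at h1
  exact mul_ne_zero hyi (hg i).1 h1.symm

theorem indep_of_lead {m : ℕ} {J : Type*} [LinearOrder J] (g : Matrix (Fin m) J ℂ)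
    (w : Fin m → J) (hw : Function.Injective w) (hg : ∀ i, LeadAt (g i) (w i))
    (y : Fin m → ℂ) (hy : y ᵥ* g = 0) : y = 0 := by
  funext i
  exact coeff_zero g w hw hg Set.univ isLowerSet_univ y (by simp [hy]) i trivial

theorem lead_set {m : ℕ} {J : Type*} [LinearOrder J] (g : Matrix (Fin m) J ℂ)
    (w : Fin m → J) (hw : Function.Injective w) (hg : ∀ i, LeadAt (g i) (w i)) (p : ℕ) (j : J) :
    (∃ x ∈ Fl g p, LeadAt x j) ↔ ∃ i : Fin m, (i:ℕ) < p ∧ w i = j := by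
  constructor
  · rintro ⟨x, ⟨y, hy, rfl⟩, hx⟩
    have hz := coeff_zero g w hw hg (Set.Iio j) (isLowerSet_Iio j) y (fun k hk => hx.2 k hk)
    have h1 := hx.1
    simp only [Matrix.vecMul, dotProduct] at h1
    obtain ⟨i, _, hi⟩ := Finset.exists_ne_zero_of_sum_ne_zero h1
    refine ⟨i, ?_, ?_⟩
    · by_contra h
      exact hi (by rw [hy i (not_lt.mp h), zero_mul])
    · rcases lt_trichotomy (w i) j with h | h | h
      · exact absurd (by rw [hz i h, zero_mul]) hi
      · exact h
      · exact absurd (by rw [(hg i).2 j h, mul_zero]) hi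
  · rintro ⟨i, hi, rfl⟩
    refine ⟨g i, ⟨Pi.single i 1, fun k hk => ?_, ?_⟩, hg i⟩
    · rw [Pi.single_eq_of_ne]
      rintro rfl
      omega
    · rw [Matrix.single_one_vecMul]; rfl

theorem lead_unique {m : ℕ} {J : Type*} [LinearOrder J] (g g' : Matrix (Fin m) J ℂ)
    (w w' : Fin m → J) (hw : Function.Injective w) (hg : ∀ i, LeadAt (g i) (w i))
    (hw' : Function.Injective w') (hg' : ∀ i, LeadAt (g' i) (w' i)) (r : ℕ)
    (hF : ∀ p ≤ r, Fl g p = Fl g' p) (i : Fin m) (hi : (i:ℕ) < r) : w i = w' i := by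
  have key : ∀ s : ℕ, ∀ i : Fin m, (i:ℕ) = s → (i:ℕ) < r → w i = w' i := by
    intro s
    induction s using Nat.strong_induction_on with
    | _ s ih =>
      intro i his hir
      have h1 := (lead_set g w hw hg (s+1) (w i)).2 ⟨i, by omega, rfl⟩
      rw [hF (s+1) (by omega)] at h1
      obtain ⟨k, hk, hk2⟩ := (lead_set g' w' hw' hg' (s+1) (w i)).1 h1
      rcases Nat.lt_or_ge (k:ℕ) s with h | h
      · have := ih k h k rfl (by omega)
        rw [hk2] at this
        have := hw this
        subst this
        omega
      · have : k = i := Fin.ext (by omega)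
        rw [← hk2, this]
  exact key i i rfl hi

theorem echelon {m : ℕ} {J : Type*} [LinearOrder J] [Finite J] (h : Matrix (Fin m) J ℂ)
    (hind : ∀ y : Fin m → ℂ, y ᵥ* h = 0 → y = 0) :
    ∃ (b : Matrix (Fin m) (Fin m) ℂ) (w : Fin m → J),
      (∀ i, b i i = 1) ∧ (∀ i j, i < j → b i j = 0) ∧ Function.Injective w ∧
      (∀ i, LeadAt ((b * h) i) (w i)) ∧
      (∀ i j, (∀ k, k < j → h i k = 0) → j ≤ w i) := by
  let C : Fin m → Set (Fin m → ℂ) := fun p => {y | y p = 1 ∧ ∀ j, p < j → y j = 0}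
  have hne : ∀ p, ∀ y ∈ C p, y ᵥ* h ≠ 0 := by
    intro p y hy h0
    have := hind y h0
    have h1 := hy.1
    rw [this] at h1
    simp at h1
  have hsing : ∀ p, Pi.single p 1 ∈ C p := by
    intro p
    refine ⟨by simp, fun j hj => ?_⟩
    rw [Pi.single_eq_of_ne hj.ne']
  have hch : ∀ p, ∃ y ∈ C p, ∃ j, (∀ k, k < j → (y ᵥ* h) k = 0) ∧
      ∀ y' ∈ C p, ∀ j', (∀ k, k < j' → (y' ᵥ* h) k = 0) → j' ≤ j := by
    intro p
    let S : Set J := {j | ∃ y ∈ C p, ∀ k, k < j → (y ᵥ* h) k = 0}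
    have hS : S.Nonempty := by
      obtain ⟨j, hj⟩ := exists_leadAt _ (hne p _ (hsing p))
      exact ⟨j, _, hsing p, hj.2⟩
    obtain ⟨j, ⟨y, hy, hyj⟩, hmax⟩ := Set.exists_max_image S id (Set.toFinite _) hS
    exact ⟨y, hy, j, hyj, fun y' hy' j' hj' => hmax j' ⟨y', hy', hj'⟩⟩
  choose b hb w hw hmax using hch
  have hlead : ∀ i, LeadAt ((b i) ᵥ* h) (w i) := by
    intro i
    obtain ⟨j, hj⟩ := exists_leadAt _ (hne i _ (hb i))
    have h1 := hmax i _ (hb i) j hj.2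
    have h2 : w i ≤ j := by
      by_contra hlt
      exact hj.1 (hw i j (not_le.mp hlt))
    rw [le_antisymm h2 h1]
    exact hj
  have hdist : ∀ i p, i < p → w i ≠ w p := by
    intro i p hip heq
    let c : ℂ := ((b p) ᵥ* h) (w p) / ((b i) ᵥ* h) (w p)
    have hy : b p - c • b i ∈ C p := by
      refine ⟨?_, fun j hj => ?_⟩
      · simp [(hb p).1, (hb i).2 p hip]
      · simp [(hb p).2 j hj, (hb i).2 j (hip.trans hj)]
    have hnz : ((b i) ᵥ* h) (w p) ≠ 0 := heq ▸ (hlead i).1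
    have hev : ∀ k, k ≤ w p → ((b p - c • b i) ᵥ* h) k = 0 := by
      intro k hk
      rw [Matrix.sub_vecMul, Matrix.smul_vecMul, Pi.sub_apply, Pi.smul_apply, smul_eq_mul]
      rcases hk.lt_or_eq with hk | rfl
      · rw [(hlead p).2 k hk, (hlead i).2 k (heq ▸ hk)]; simp
      · rw [div_mul_cancel₀ _ hnz, sub_self]
    obtain ⟨j, hj⟩ := exists_leadAt _ (hne p _ hy)
    have h1 := hmax p _ hy j hj.2
    exact hj.1 (hev j h1)
  refine ⟨b, w, fun i => (hb i).1, fun i j hij => (hb i).2 j hij, ?_, ?_, ?_⟩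
  · intro i p heq
    rcases lt_trichotomy i p with hl | hl | hl
    · exact absurd heq (hdist i p hl)
    · exact hl
    · exact absurd heq.symm (hdist p i hl)
  · intro i
    exact hlead i
  · intro i j hij
    refine hmax i _ (hsing i) j ?_
    intro k hk
    rw [Matrix.single_one_vecMul]
    exact hij k hk

/-! ### Triangular matrices -/

theorem isUnit_of_diag_lower {k : ℕ} (M : Mat k k) (hd : ∀ i, M i i ≠ 0)
    (hl : ∀ i j : Fin k, i < j → M i j = 0) : IsUnit M := by
  rw [Matrix.isUnit_iff_isUnit_det, Matrix.det_of_isLowerTriangular M (fun i j hij => hl i j hij)]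
  exact isUnit_iff_ne_zero.mpr (Finset.prod_ne_zero_iff.mpr fun i _ => hd i)

theorem isUnit_of_diag_upper {k : ℕ} (M : Mat k k) (hd : ∀ i, M i i ≠ 0)
    (hl : ∀ i j : Fin k, j < i → M i j = 0) : IsUnit M := by
  rw [Matrix.isUnit_iff_isUnit_det, Matrix.det_of_isUpperTriangular (fun i j hij => hl i j hij)]
  exact isUnit_iff_ne_zero.mpr (Finset.prod_ne_zero_iff.mpr fun i _ => hd i)

theorem diag_of_Bm {k : ℕ} (M : Mat k k) (h : M ∈ Bm k) (i : Fin k) : M i i ≠ 0 := by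
  have := h.1
  rw [Matrix.isUnit_iff_isUnit_det, Matrix.det_of_isLowerTriangular M (fun i j hij => h.2 i j hij)] at this
  exact Finset.prod_ne_zero_iff.mp this.ne_zero i (Finset.mem_univ i)

theorem diag_of_Bp {k : ℕ} (M : Mat k k) (h : M ∈ Bp k) (i : Fin k) : M i i ≠ 0 := by
  have := h.1
  rw [Matrix.isUnit_iff_isUnit_det, Matrix.det_of_isUpperTriangular (fun i j hij => h.2 i j hij)] at this
  exact Finset.prod_ne_zero_iff.mp this.ne_zero i (Finset.mem_univ i)

theorem Bm_inv_s16 {k : ℕ} (M : Mat k k) (h : M ∈ Bm k) : M⁻¹ ∈ Bm k := by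
  refine ⟨by simpa using h.1, ?_⟩
  have := h.1.invertible
  have hb : Matrix.BlockTriangular M OrderDual.toDual := fun i j hij => h.2 i j hij
  have := Matrix.blockTriangular_inv_of_blockTriangular hb
  exact fun i j hij => this hij

theorem Bm_mul_s16 {k : ℕ} (M N : Mat k k) (h : M ∈ Bm k) (h' : N ∈ Bm k) : M * N ∈ Bm k := by
  refine ⟨h.1.mul h'.1, ?_⟩
  have hb : Matrix.BlockTriangular M OrderDual.toDual := fun i j hij => h.2 i j hij
  have hb' : Matrix.BlockTriangular N OrderDual.toDual := fun i j hij => h'.2 i j hij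
  exact fun i j hij => (hb.mul hb') hij

theorem permMat_mul_s16 {k : ℕ} (w : Equiv.Perm (Fin k)) (M : Mat k k) (i j : Fin k) :
    (permMat k w * M) i j = M (w⁻¹ i) j := by
  simp only [Matrix.mul_apply, permMat, ite_mul, one_mul, zero_mul]
  rw [Finset.sum_eq_single (w⁻¹ i)]
  · simp
  · intro b _ hb
    rw [if_neg]
    rintro rfl
    simp at hb
  · simp

theorem Fl_mono_lower {k : ℕ} (b g : Mat k k) (hb : b ∈ Bm k) (p : ℕ) :
    Fl (b * g) p ⊆ Fl g p := by
  rintro x ⟨y, hy, rfl⟩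
  refine ⟨y ᵥ* b, fun i hi => ?_, by rw [Matrix.vecMul_vecMul]⟩
  simp only [Matrix.vecMul, dotProduct]
  refine Finset.sum_eq_zero fun l _ => ?_
  rcases lt_or_ge l i with h | h
  · rw [hb.2 l i h, mul_zero]
  · rw [hy l (le_trans hi h), zero_mul]

theorem Fl_mul {k : ℕ} (b g : Mat k k) (hb : b ∈ Bm k) (p : ℕ) : Fl (b * g) p = Fl g p := by
  refine (Fl_mono_lower b g hb p).antisymm ?_
  have := Fl_mono_lower b⁻¹ (b * g) (Bm_inv_s16 b hb) p
  rwa [Matrix.nonsing_inv_mul_cancel_left _ _ ((Matrix.isUnit_iff_isUnit_det b).mp hb.1)] at this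

theorem Fl_congr {k : ℕ} (g g' : Mat k k) (t : ℕ) (h : ∀ i : Fin k, (i:ℕ) < t → g i = g' i)
    (p : ℕ) (hp : p ≤ t) : Fl g p ⊆ Fl g' p := by
  rintro x ⟨y, hy, rfl⟩
  refine ⟨y, hy, ?_⟩
  funext j
  simp only [Matrix.vecMul, dotProduct]
  refine Finset.sum_congr rfl fun i _ => ?_
  rcases Nat.lt_or_ge (i:ℕ) p with hi | hi
  · rw [h i (by omega)]
  · rw [hy i hi, zero_mul, zero_mul]


/-! ### The Bruhat comparison -/

/-- `j` is the last position where `x` is nonzero. -/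
def TrailAt {n : ℕ} (x : Fin n → ℂ) (j : Fin n) : Prop :=
  x j ≠ 0 ∧ ∀ k, j < k → x k = 0

theorem linInd_of_indep {m : ℕ} {J : Type*} (g : Matrix (Fin m) J ℂ)
    (h : ∀ y : Fin m → ℂ, y ᵥ* g = 0 → y = 0) : LinearIndependent ℂ (fun i => g i) := by
  rw [Fintype.linearIndependent_iff]
  intro y hy i
  have : y = 0 := by
    apply h
    rw [← hy]
    funext j
    simp [Matrix.vecMul, dotProduct]
  rw [this]; rfl

theorem indep_of_trail {m n : ℕ} (g : Mat m n) (u : Fin m → Fin n) (hu : Function.Injective u)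
    (hg : ∀ i, TrailAt (g i) (u i)) (y : Fin m → ℂ) (hy : y ᵥ* g = 0) : y = 0 :=
  indep_of_lead (J := (Fin n)ᵒᵈ) g u hu hg y hy

theorem count_le {n : ℕ} (b g : Mat n n) (hb : b ∈ Bm n) (u v : Equiv.Perm (Fin n))
    (hv : ∀ i, LeadAt ((b * g) i) (v i)) (hu : ∀ i, TrailAt (g i) (u i)) (p : ℕ) (q : Fin n) :
    (Finset.univ.filter (fun i : Fin n => (i:ℕ) < p ∧ q ≤ v i)).card
      + (Finset.univ.filter (fun i : Fin n => (i:ℕ) < p ∧ u i < q)).card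
      ≤ (Finset.univ.filter (fun i : Fin n => (i:ℕ) < p)).card := by
  classical
  have l1 := linInd_of_indep _ (indep_of_lead (b * g) v v.injective hv)
  have l2 := linInd_of_indep _ (indep_of_trail g u u.injective hu)
  let f1 : {i : Fin n // (i:ℕ) < p ∧ q ≤ v i} → (Fin n → ℂ) := fun i => (b * g) i.1
  let f2 : {i : Fin n // (i:ℕ) < p ∧ u i < q} → (Fin n → ℂ) := fun i => g i.1
  have l1' : LinearIndependent ℂ f1 := l1.comp Subtype.val Subtype.val_injective
  have l2' : LinearIndependent ℂ f2 := l2.comp Subtype.val Subtype.val_injective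
  let H : Submodule ℂ (Fin n → ℂ) :=
    { carrier := {x | ∀ k, k < q → x k = 0}
      add_mem' := fun {x y} hx hy k hk => by simp [hx k hk, hy k hk]
      zero_mem' := fun k _ => rfl
      smul_mem' := fun c x hx k hk => by simp [hx k hk] }
  let G : Submodule ℂ (Fin n → ℂ) :=
    { carrier := {x | ∀ k, q ≤ k → x k = 0}
      add_mem' := fun {x y} hx hy k hk => by simp [hx k hk, hy k hk]
      zero_mem' := fun k _ => rfl
      smul_mem' := fun c x hx k hk => by simp [hx k hk] }
  have hHG : Disjoint H G := by
    rw [Submodule.disjoint_def]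
    intro x hx hx'
    funext k
    rcases lt_or_ge k q with hk | hk
    · exact hx k hk
    · exact hx' k hk
  have s1 : Submodule.span ℂ (Set.range f1) ≤ H := by
    rw [Submodule.span_le]
    rintro _ ⟨⟨i, hi, hqi⟩, rfl⟩ k hk
    exact (hv i).2 k (lt_of_lt_of_le hk hqi)
  have s2 : Submodule.span ℂ (Set.range f2) ≤ G := by
    rw [Submodule.span_le]
    rintro _ ⟨⟨i, hi, hqi⟩, rfl⟩ k hk
    exact (hu i).2 k (lt_of_lt_of_le hqi hk)
  have l3 := l1'.sum_type l2' (hHG.mono s1 s2)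
  let W : Finset (Fin n → ℂ) := (Finset.univ.filter (fun i : Fin n => (i:ℕ) < p)).image (fun i => g i)
  have hWmem : ∀ i : Fin n, (i:ℕ) < p → g i ∈ (W : Set (Fin n → ℂ)) := by
    intro i hi
    simp only [W, Finset.coe_image]
    exact ⟨i, by simpa using hi, rfl⟩
  have hr : Set.range (Sum.elim f1 f2) ≤ (Submodule.span ℂ (W : Set (Fin n → ℂ)) : Set _) := by
    rintro _ ⟨i | i, rfl⟩
    · obtain ⟨i, hi, hqi⟩ := i
      have : f1 ⟨i, hi, hqi⟩ = ∑ k, b i k • g k := by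
        funext j
        simp [f1, Matrix.mul_apply]
      simp only [Sum.elim_inl]
      rw [this]
      refine Submodule.sum_mem _ fun k _ => ?_
      rcases lt_or_ge i k with hk | hk
      · rw [hb.2 i k hk, zero_smul]; exact Submodule.zero_mem _
      · exact Submodule.smul_mem _ _ (Submodule.subset_span (hWmem k (lt_of_le_of_lt hk hi)))
    · exact Submodule.subset_span (hWmem i.1 i.2.1)
  have h4 := linearIndependent_le_span' _ l3 (W : Set (Fin n → ℂ)) hr
  have h5 : Fintype.card ({i : Fin n // (i:ℕ) < p ∧ q ≤ v i} ⊕ {i : Fin n // (i:ℕ) < p ∧ u i < q})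
      ≤ W.card := by
    rw [Cardinal.mk_fintype] at h4
    rw [← Fintype.card_coe W]
    exact_mod_cast h4
  rw [Fintype.card_sum, Fintype.card_subtype, Fintype.card_subtype] at h5
  exact h5.trans Finset.card_image_le

theorem finsetLE_of_count {n : ℕ} (A B : Finset (Fin n)) (hAB : A.card = B.card)
    (h : ∀ q, (A.filter (fun x => q ≤ x)).card ≤ (B.filter (fun x => q ≤ x)).card) :
    finsetLE A B := by
  unfold finsetLE
  rw [List.forall₂_iff_get]
  refine ⟨by simp [hAB], ?_⟩
  intro i h₁ h₂
  by_contra hlt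
  rw [not_le] at hlt
  have hiA : i < A.card := by simpa using h₁
  have hiB : i < B.card := by simpa using h₂
  set eA := A.orderEmbOfFin rfl
  set eB := B.orderEmbOfFin rfl
  have hlt' : eB ⟨i, hiB⟩ < eA ⟨i, hiA⟩ := hlt
  have := h (eA ⟨i, hiA⟩)
  have h1 : A.card - i ≤ (A.filter (fun x => eA ⟨i, hiA⟩ ≤ x)).card := by
    have hs : (Finset.Ici (⟨i, hiA⟩ : Fin A.card)).image eA ⊆ A.filter (fun x => eA ⟨i, hiA⟩ ≤ x) := by
      intro x hx
      rw [Finset.mem_image] at hx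
      obtain ⟨k, hk, rfl⟩ := hx
      rw [Finset.mem_filter]
      exact ⟨A.orderEmbOfFin_mem rfl k, eA.monotone (Finset.mem_Ici.mp hk)⟩
    have := Finset.card_le_card hs
    rw [Finset.card_image_of_injective _ eA.injective, Fin.card_Ici] at this
    exact this
  have h2 : (B.filter (fun x => eA ⟨i, hiA⟩ ≤ x)).card ≤ B.card - 1 - i := by
    have hs : B.filter (fun x => eA ⟨i, hiA⟩ ≤ x) ⊆ (Finset.Ioi (⟨i, hiB⟩ : Fin B.card)).image eB := by
      intro x hx
      rw [Finset.mem_filter] at hx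
      have hx1 : x ∈ Set.range eB := by
        rw [Finset.range_orderEmbOfFin]; exact hx.1
      obtain ⟨k, rfl⟩ := hx1
      rw [Finset.mem_image]
      refine ⟨k, ?_, rfl⟩
      rw [Finset.mem_Ioi]
      exact eB.lt_iff_lt.mp (lt_of_lt_of_le hlt' hx.2)
    have := Finset.card_le_card hs
    rw [Finset.card_image_of_injective _ eB.injective, Fin.card_Ioi] at this
    exact this
  omega

theorem bruhat_of_flags {n : ℕ} (b g : Mat n n) (hb : b ∈ Bm n) (u v : Equiv.Perm (Fin n))
    (hv : ∀ i, LeadAt ((b * g) i) (v i)) (hu : ∀ i, TrailAt (g i) (u i)) : bruhatLE v u := by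
  intro p
  apply finsetLE_of_count
  · rw [Finset.card_image_of_injective _ v.injective, Finset.card_image_of_injective _ u.injective]
  · intro q
    have h1 := count_le b g hb u v hv hu (p+1) q
    have h2 : ∀ w : Equiv.Perm (Fin n), (((Finset.Iic p).image w).filter (fun x => q ≤ x)).card =
        (Finset.univ.filter (fun i : Fin n => (i:ℕ) < (p:ℕ)+1 ∧ q ≤ w i)).card := by
      intro w
      rw [Finset.filter_image, Finset.card_image_of_injective _ w.injective]
      congr 1
      ext i
      simp only [Finset.mem_filter, Finset.mem_Iic, Finset.mem_univ, true_and, Fin.le_def]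
      constructor <;> rintro ⟨h, h'⟩ <;> exact ⟨by omega, h'⟩
    rw [h2, h2]
    have h3 : (Finset.univ.filter (fun i : Fin n => (i:ℕ) < (p:ℕ)+1)).card =
      (Finset.univ.filter (fun i : Fin n => (i:ℕ) < (p:ℕ)+1 ∧ q ≤ u i)).card
       + (Finset.univ.filter (fun i : Fin n => (i:ℕ) < (p:ℕ)+1 ∧ u i < q)).card := by
      rw [← Finset.card_filter_add_card_filter_not (fun i => q ≤ u i), Finset.filter_filter,
        Finset.filter_filter]
      simp only [not_le]
    omega

/-! ### Uniqueness of `u` -/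

theorem tail_le {n t : ℕ} (u u' : Equiv.Perm (Fin n)) (hu' : tailMono t u')
    (p : Fin n) (hp : t ≤ (p:ℕ)) (h : ∀ i, i < p → u i = u' i) : u' p ≤ u p := by
  obtain ⟨i, hi⟩ := u'.surjective (u p)
  rcases lt_trichotomy i p with hl | hl | hl
  · rw [← h i hl] at hi
    exact absurd (u.injective hi) hl.ne
  · rw [← hi, hl]
  · rw [← hi]
    exact (hu' p i hl hp).le

theorem tail_unique {n t : ℕ} (u u' : Equiv.Perm (Fin n)) (hu : tailMono t u) (hu' : tailMono t u')
    (h : ∀ i : Fin n, (i:ℕ) < t → u i = u' i) : u = u' := by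
  ext1 p
  induction p using WellFoundedLT.induction with
  | _ p ih =>
    rcases Nat.lt_or_ge (p:ℕ) t with hp | hp
    · exact h p hp
    · exact le_antisymm (tail_le u' u hu p hp fun i hi => (ih i hi).symm) (tail_le u u' hu' p hp ih)

theorem Fl_tail {n t : ℕ} (u : Equiv.Perm (Fin n)) (hu : tailMono t u) (g g' : Mat n n)
    (hg : ∀ i, TrailAt (g i) (u i)) (hg' : ∀ i, TrailAt (g' i) (u i)) (hgu : IsUnit g')
    (h : Fl g t ⊆ Fl g' t) (p : ℕ) (hp : t ≤ p) : Fl g p ⊆ Fl g' p := by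
  rintro x ⟨y, hy, rfl⟩
  let y1 : Fin n → ℂ := fun i => if (i:ℕ) < t then y i else 0
  let y2 : Fin n → ℂ := fun i => if (i:ℕ) < t then 0 else y i
  have hy12 : y = y1 + y2 := by
    funext i
    simp only [y1, y2, Pi.add_apply]
    split_ifs <;> simp
  obtain ⟨z1, hz1, hz1e⟩ := h ⟨y1, fun i hi => by simp [y1, hi], rfl⟩
  let z2 : Fin n → ℂ := (y2 ᵥ* g) ᵥ* g'⁻¹
  have hz2e : y2 ᵥ* g = z2 ᵥ* g' := by
    simp only [z2]
    rw [Matrix.vecMul_vecMul _ g'⁻¹, Matrix.nonsing_inv_mul _ ((Matrix.isUnit_iff_isUnit_det g').mp hgu),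
      Matrix.vecMul_one]
  refine ⟨z1 + z2, fun i hi => ?_, ?_⟩
  · have h1 := hz1 i (hp.trans hi)
    have h2 : z2 i = 0 := by
      refine coeff_zero (J := (Fin n)ᵒᵈ) g' u u.injective hg' {j : Fin n | u i ≤ j}
        (fun a b hab ha => le_trans (α := Fin n) ha hab) z2 ?_ i (le_refl (u i))
      intro j hj
      change (z2 ᵥ* g') j = 0
      rw [← hz2e]
      simp only [Matrix.vecMul, dotProduct]
      refine Finset.sum_eq_zero fun k _ => ?_
      simp only [y2]
      split_ifs with hk
      · simp
      · rcases Nat.lt_or_ge (k:ℕ) p with hkp | hkp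
        · have hki : u k < u i := hu k i (Fin.lt_def.mpr (by omega)) (by omega)
          rw [(hg k).2 j (lt_of_lt_of_le hki hj), mul_zero]
        · rw [hy k hkp, zero_mul]
    simp [h1, h2]
  · rw [hy12, Matrix.add_vecMul, Matrix.add_vecMul, hz1e, hz2e]

/-! ### Extending an injection to a permutation -/

theorem exists_perm_tail {n t : ℕ} (ht : t ≤ n) (w : Fin t → Fin n) (hw : Function.Injective w) :
    ∃ u : Equiv.Perm (Fin n), tailMono t u ∧ ∀ i : Fin t, u (Fin.castLE ht i) = w i := by
  classical
  let S : Finset (Fin n) := (Finset.univ.image w)ᶜ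
  have hS : S.card = n - t := by
    rw [Finset.card_compl, Finset.card_image_of_injective _ hw]; simp
  let e := S.orderEmbOfFin hS
  have heS : ∀ k i, e k ≠ w i := by
    intro k i h
    have : e k ∈ S := S.orderEmbOfFin_mem hS k
    simp only [S, Finset.mem_compl, Finset.mem_image, not_exists] at this
    exact this i ⟨Finset.mem_univ _, h.symm⟩
  let f : Fin n → Fin n := fun i => if h : (i:ℕ) < t then w ⟨i, h⟩ else e ⟨i - t, by omega⟩
  have hf : Function.Injective f := by
    intro i j hij
    simp only [f] at hij
    split_ifs at hij with h1 h2 h2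
    · have := hw hij
      simp only [Fin.mk.injEq] at this
      exact Fin.ext this
    · exact absurd hij.symm (heS _ _)
    · exact absurd hij (heS _ _)
    · have := e.injective hij
      simp only [Fin.mk.injEq] at this
      exact Fin.ext (by omega)
  refine ⟨Equiv.ofBijective f (Finite.injective_iff_bijective.mp hf), ?_, ?_⟩
  · intro i j hij hi
    simp only [Equiv.ofBijective_apply, f]
    have hij' : (i:ℕ) < j := hij
    rw [dif_neg (by omega), dif_neg (by omega)]
    exact e.strictMono (Fin.lt_def.mpr (by simp; omega))
  · intro i
    simp [f]


/-! ### Main argument -/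

theorem Imn_mul_s16 {n t : ℕ} (ht : t ≤ n) (h : Mat n n) (i : Fin t) :
    (Imn t n t * h) i = h (Fin.castLE ht i) := by
  funext j
  simp only [Matrix.mul_apply, Imn, ite_mul, one_mul, zero_mul]
  rw [Finset.sum_eq_single (Fin.castLE ht i)]
  · simp
  · intro b _ hb
    rw [if_neg]
    rintro ⟨h1, _⟩
    exact hb (Fin.ext h1.symm)
  · simp

theorem Rset_data {n t : ℕ} (ht : t ≤ n) (u v : Equiv.Perm (Fin n)) (a : Mat t n)
    (ha : a ∈ Rset n t u v) :
    ∃ b g : Mat n n, b ∈ Bm n ∧ IsUnit g ∧ (∀ i, TrailAt (g i) (u i)) ∧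
      (∀ i, LeadAt ((b * g) i) (v i)) ∧ ∀ i : Fin t, a i = (b * g) (Fin.castLE ht i) := by
  obtain ⟨h, ⟨⟨b, hb, b', hb', rfl⟩, ⟨c, hc, he⟩⟩, rfl⟩ := ha
  have hrow : ∀ i, TrailAt ((permMat n u⁻¹ * b') i) (u i) := by
    intro i
    refine ⟨?_, fun k hk => ?_⟩
    · rw [permMat_mul_s16, inv_inv]; exact diag_of_Bm b' hb' _
    · rw [permMat_mul_s16, inv_inv]; exact hb'.2 _ _ hk
  refine ⟨b, permMat n u⁻¹ * b', hb, ?_, hrow, ?_, ?_⟩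
  · exact Matrix.linearIndependent_rows_iff_isUnit.mp
      (linInd_of_indep _ (indep_of_trail _ u u.injective hrow))
  · rw [← Matrix.mul_assoc, he]
    intro i
    refine ⟨?_, fun k hk => ?_⟩
    · rw [permMat_mul_s16, inv_inv]; exact diag_of_Bp c hc _
    · rw [permMat_mul_s16, inv_inv]; exact hc.2 _ _ hk
  · intro i
    rw [Imn_mul_s16 ht, Matrix.mul_assoc]

theorem Rset_disj {n t : ℕ} (ht : t ≤ n) (u v u' v' : Equiv.Perm (Fin n)) (a : Mat t n)
    (hu : tailMono t u) (hu' : tailMono t u')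
    (ha : a ∈ Rset n t u v) (ha' : a ∈ Rset n t u' v') : u = u' ∧ v = v' := by
  obtain ⟨b, g, hb, hgu, hg, hv, hr⟩ := Rset_data ht u v a ha
  obtain ⟨b', g', hb', hgu', hg', hv', hr'⟩ := Rset_data ht u' v' a ha'
  have hrow : ∀ i : Fin n, (i:ℕ) < t → (b * g) i = (b' * g') i := by
    intro i hi
    exact (hr ⟨i, hi⟩).symm.trans (hr' ⟨i, hi⟩)
  have hF : ∀ p ≤ t, Fl g p = Fl g' p := by
    intro p hp
    rw [← Fl_mul b g hb, ← Fl_mul b' g' hb']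
    exact (Fl_congr _ _ t hrow p hp).antisymm (Fl_congr _ _ t (fun i hi => (hrow i hi).symm) p hp)
  have huu : u = u' := by
    apply tail_unique u u' hu hu'
    intro i hi
    exact lead_unique (J := (Fin n)ᵒᵈ) g g' u u' u.injective hg u'.injective hg' t hF i hi
  subst huu
  refine ⟨rfl, ?_⟩
  have hF' : ∀ p, Fl g p = Fl g' p := by
    intro p
    rcases le_total p t with hp | hp
    · exact hF p hp
    · exact (Fl_tail u hu g g' hg hg' hgu' (hF t le_rfl).le p hp).antisymm
        (Fl_tail u hu g' g hg' hg hgu (hF t le_rfl).ge p hp)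
  ext1 i
  refine lead_unique (b * g) (b' * g') v v' v.injective hv v'.injective hv' n ?_ i i.2
  intro p _
  rw [Fl_mul b g hb, Fl_mul b' g' hb', hF']

theorem exists_uv {n t : ℕ} (ht : t ≤ n) (c : Fin t → Fin n) (hc : StrictMono c) (a : Mat t n)
    (ha : a ∈ Rnc n t c) :
    ∃ u v : Equiv.Perm (Fin n),
        tailMono t u ∧ headMono t v ∧ bruhatLE v u ∧
        (∀ i : Fin t, v (Fin.castLE ht i) = c i) ∧ a ∈ Rset n t u v := by
  classical
  have hal : ∀ i, LeadAt (a i) (c i) := fun i => ⟨ha.1 i, fun k hk => ha.2 i k hk⟩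
  have haind := indep_of_lead a c hc.injective hal
  obtain ⟨b1, w, hb1d, hb1l, hwinj, hwl, -⟩ := echelon (J := (Fin n)ᵒᵈ) a haind
  obtain ⟨u, hut, huw⟩ := exists_perm_tail ht w hwinj
  -- the extended matrix
  let h0 : Mat n n := fun i => if h : (i:ℕ) < t then a ⟨i, h⟩ else Pi.single (u i) 1
  let B : Mat n n := fun i j => if h : (i:ℕ) < t ∧ (j:ℕ) < t then b1 ⟨i, h.1⟩ ⟨j, h.2⟩
    else if i = j then 1 else 0
  have hBl : ∀ i j, i < j → B i j = 0 := by
    intro i j hij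
    simp only [B]
    split_ifs with h1 h2
    · exact hb1l _ _ hij
    · exact absurd h2 hij.ne
    · rfl
  have hB : B ∈ Bm n := by
    refine ⟨isUnit_of_diag_lower B (fun i => ?_) hBl, hBl⟩
    simp only [B]
    split_ifs with h1
    · rw [hb1d]; exact one_ne_zero
    · exact one_ne_zero
  have hg1 : ∀ i : Fin t, (B * h0) (Fin.castLE ht i) = (b1 * a) i := by
    intro i
    funext j
    simp only [Matrix.mul_apply]
    symm
    refine Finset.sum_of_injOn (Fin.castLE ht) (Fin.castLE_injective ht).injOn (by simp) ?_ ?_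
    · intro k _ hk
      have hk' : ¬ (k:ℕ) < t := by
        intro hkt
        exact hk ⟨⟨k, hkt⟩, by simp, rfl⟩
      have : Fin.castLE ht i ≠ k := by
        rintro rfl
        exact hk' i.2
      simp [B, hk', this]
    · intro k _
      simp [B, h0]
  have hg2 : ∀ i : Fin n, ¬ (i:ℕ) < t → (B * h0) i = Pi.single (u i) 1 := by
    intro i hi
    funext j
    rw [Matrix.mul_apply]
    simp [B, h0, hi]
  have hg : ∀ i, TrailAt ((B * h0) i) (u i) := by
    intro i
    by_cases hi : (i:ℕ) < t
    · have h1 : u i = w ⟨i, hi⟩ := huw ⟨i, hi⟩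
      have h2 : (B * h0) i = (b1 * a) ⟨i, hi⟩ := hg1 ⟨i, hi⟩
      rw [h1, h2]
      exact hwl ⟨i, hi⟩
    · rw [hg2 i hi]
      refine ⟨by simp, fun k hk => ?_⟩
      rw [Pi.single_eq_of_ne hk.ne']
  set g := B * h0 with hgdef
  have hgu : IsUnit g := Matrix.linearIndependent_rows_iff_isUnit.mp
      (linInd_of_indep _ (indep_of_trail _ u u.injective hg))
  have hh0 : h0 = B⁻¹ * g := by
    rw [hgdef, Matrix.nonsing_inv_mul_cancel_left _ _ ((Matrix.isUnit_iff_isUnit_det B).mp hB.1)]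
  have hh0u : IsUnit h0 := by
    rw [hh0]; exact (Bm_inv_s16 B hB).1.mul hgu
  obtain ⟨b2, w2, hb2d, hb2l, hw2inj, hw2l, hmax⟩ := echelon h0 (fun y hy =>
    Matrix.vecMul_injective_of_isUnit hh0u (by simpa using hy))
  have hb2 : b2 ∈ Bm n := ⟨isUnit_of_diag_lower b2 (fun i => by rw [hb2d]; exact one_ne_zero) hb2l, hb2l⟩
  -- the first rows are unchanged
  have htop0 : ∀ i : Fin t, h0 (Fin.castLE ht i) = a i := by
    intro i
    simp [h0]
  have htop : ∀ i : Fin t, (b2 * h0) (Fin.castLE ht i) = a i := by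
    intro i
    have hle : c i ≤ w2 (Fin.castLE ht i) := by
      apply hmax
      intro k hk
      rw [htop0]
      exact ha.2 i k hk
    let y : Fin t → ℂ := fun k => b2 (Fin.castLE ht i) (Fin.castLE ht k)
    have hy : (b2 * h0) (Fin.castLE ht i) = y ᵥ* a := by
      funext j
      simp only [Matrix.mul_apply, Matrix.vecMul, dotProduct]
      symm
      refine Finset.sum_of_injOn (Fin.castLE ht) (Fin.castLE_injective ht).injOn (by simp) ?_ ?_
      · intro k _ hk
        have hk' : ¬ (k:ℕ) < t := by
          intro hkt
          exact hk ⟨⟨k, hkt⟩, by simp, rfl⟩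
        rw [hb2l, zero_mul]
        rw [Fin.lt_def]
        have := i.2
        simp only [Fin.val_castLE]
        omega
      · intro k _
        simp only [y]
        rw [htop0]
    have hz := coeff_zero a c hc.injective hal (Set.Iio (c i)) (isLowerSet_Iio _) y (by
      intro j hj
      rw [← hy]
      exact (hw2l _).2 j (lt_of_lt_of_le hj hle))
    have hys : y = Pi.single i 1 := by
      funext k
      rcases lt_trichotomy k i with hk | hk | hk
      · rw [Pi.single_eq_of_ne hk.ne]
        exact hz k (hc hk)
      · subst hk
        rw [Pi.single_eq_same]
        exact hb2d _
      · rw [Pi.single_eq_of_ne hk.ne']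
        exact hb2l _ _ hk
    rw [hy, hys, Matrix.single_one_vecMul]
    rfl
  let v : Equiv.Perm (Fin n) := Equiv.ofBijective w2 (Finite.injective_iff_bijective.mp hw2inj)
  have hvl : ∀ i, LeadAt ((b2 * h0) i) (v i) := hw2l
  have hvc : ∀ i : Fin t, v (Fin.castLE ht i) = c i := by
    intro i
    have h1 := hvl (Fin.castLE ht i)
    rw [htop] at h1
    rcases lt_trichotomy (v (Fin.castLE ht i)) (c i) with h | h | h
    · exact absurd ((hal i).2 _ h) h1.1
    · exact h
    · exact absurd (h1.2 _ h) (hal i).1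
  have hbB : b2 * B⁻¹ ∈ Bm n := Bm_mul_s16 _ _ hb2 (Bm_inv_s16 B hB)
  have hhg : b2 * h0 = (b2 * B⁻¹) * g := by
    rw [Matrix.mul_assoc, ← hh0]
  refine ⟨u, v, hut, ?_, ?_, hvc, ?_⟩
  · intro i j hij hj
    have hij' : (i:ℕ) < j := hij
    have h1 : v i = c ⟨i, by omega⟩ := hvc ⟨i, by omega⟩
    have h2 : v j = c ⟨j, hj⟩ := hvc ⟨j, hj⟩
    rw [h1, h2]
    exact hc hij
  · exact bruhat_of_flags (b2 * B⁻¹) g hbB u v (by rw [← hhg]; exact hvl) hg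
  · refine ⟨b2 * h0, ⟨⟨b2 * B⁻¹, hbB, permMat n u * g, ?_, ?_⟩, ⟨permMat n v * (b2 * h0), ?_, ?_⟩⟩, ?_⟩
    · have hl : ∀ i j : Fin n, i < j → (permMat n u * g) i j = 0 := by
        intro i j hij
        rw [permMat_mul_s16]
        exact (hg (u⁻¹ i)).2 j (by simpa using hij)
      refine ⟨isUnit_of_diag_lower _ (fun i => ?_) hl, hl⟩
      rw [permMat_mul_s16]
      simpa using (hg (u⁻¹ i)).1
    · rw [hhg, Matrix.mul_assoc _ (permMat n u⁻¹)]
      congr 1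
      ext i j
      rw [permMat_mul_s16, permMat_mul_s16]
      simp
    · have hl : ∀ i j : Fin n, j < i → (permMat n v * (b2 * h0)) i j = 0 := by
        intro i j hij
        rw [permMat_mul_s16]
        exact (hvl (v⁻¹ i)).2 j (by simpa using hij)
      refine ⟨isUnit_of_diag_upper _ (fun i => ?_) hl, hl⟩
      rw [permMat_mul_s16]
      simpa using (hvl (v⁻¹ i)).1
    · ext i j
      rw [permMat_mul_s16, permMat_mul_s16]
      simp
    · ext1 i
      exact ((Imn_mul_s16 ht (b2 * h0) i).trans (htop i)).symm ▸ fun _ => rfl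

theorem statement16 (n t : ℕ) (hn : 0 < n) (ht : t ≤ n)
    (c : Fin t → Fin n) (hc : StrictMono c) :
    (∀ a : Mat t n, a ∈ Rnc n t c ↔
      ∃ u v : Equiv.Perm (Fin n),
        tailMono t u ∧ headMono t v ∧ bruhatLE v u ∧
        (∀ i : Fin t, v (Fin.castLE ht i) = c i) ∧
        a ∈ Rset n t u v) ∧
    (∀ u v u' v' : Equiv.Perm (Fin n),
      tailMono t u → headMono t v → bruhatLE v u → (∀ i : Fin t, v (Fin.castLE ht i) = c i) →
      tailMono t u' → headMono t v' → bruhatLE v' u' → (∀ i : Fin t, v' (Fin.castLE ht i) = c i) →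
      (u, v) ≠ (u', v') → Disjoint (Rset n t u v) (Rset n t u' v')) := by
  constructor
  · intro a
    constructor
    · exact exists_uv ht c hc a
    · rintro ⟨u, v, -, -, -, hvc, ha⟩
      obtain ⟨b, g, -, -, -, hv, hr⟩ := Rset_data ht u v a ha
      have hl : ∀ i, LeadAt (a i) (c i) := by
        intro i
        rw [hr i, ← hvc i]
        exact hv _
      exact ⟨fun i => (hl i).1, fun i j hj => (hl i).2 j hj⟩
  · intro u v u' v' hu _ _ _ hu' _ _ _ hne
    rw [Set.disjoint_left]
    intro a ha ha'
    obtain ⟨h1, h2⟩ := Rset_disj ht u v u' v' a hu hu' ha ha'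
    exact hne (by rw [h1, h2])
end
end
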